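/- arXiv:1606.03862 — 3 statements merged into one kernel-verified Lean document; each statement's English description precedes it below -/
import Mathlib

section
/- For every finitely generated abelian group H there exists a countable row-finite directed graph E such that the graph monoid M(E) is isomorphic to the monoid H⁰ obtained from H by adjoining a new neutral element 0; in particular the set of nonzero elements of M(E) is a subsemigroup which is a group isomorphic to H. -/
namespace ArPardo

/-- A countable row-finite directed graph `E = (E⁰, E¹, s, r)`. -/
structure RowFiniteGraph : Type 1 where
  V : Type
  E : Type
  countableV : Countable V
  countableE : Countable E
  s : E → V
  r : E → V
  rowFinite : ∀ v : V, {e : E | s e = v}.Finite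

/-- The defining relations of the graph monoid, as a relation on the free
commutative monoid `V →₀ ℕ` on the vertices: for every vertex `v` emitting
at least one edge, `a_v = Σ_{e ∈ s⁻¹(v)} a_{r(e)}`. -/
def graphRel (G : RowFiniteGraph) (x y : G.V →₀ ℕ) : Prop :=
  ∃ v : G.V, (∃ e : G.E, G.s e = v) ∧ x = Finsupp.single v 1 ∧
    y = ∑ e ∈ (G.rowFinite v).toFinset, Finsupp.single (G.r e) 1

/-- The graph monoid `M(E)`: the quotient of the free commutative monoid on the
vertices by the congruence generated by the graph relations. -/
def graphMonoid (G : RowFiniteGraph) : Type :=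
  (addConGen (graphRel G)).Quotient

noncomputable instance (G : RowFiniteGraph) : AddCommMonoid (graphMonoid G) :=
  inferInstanceAs (AddCommMonoid (addConGen (graphRel G)).Quotient)

/-- The canonical generator `a_v` of the graph monoid. -/
noncomputable def vertexElem (G : RowFiniteGraph) (v : G.V) : graphMonoid G :=
  (addConGen (graphRel G)).mk' (Finsupp.single v 1)

/-- A commutative monoid is a graph monoid if it is isomorphic to `M(E)` for some
(countable) row-finite directed graph `E`. -/
def IsGraphMonoid (M : Type) [AddCommMonoid M] : Prop :=
  ∃ G : RowFiniteGraph, Nonempty (M ≃+ graphMonoid G)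

/-- The algebraic preorder on a commutative monoid: `x ≤ y` iff `y = x + z`. -/
def algLE {M : Type} [AddCommMonoid M] (x y : M) : Prop :=
  ∃ z : M, y = x + z

/-- A commutative monoid is conical if `x + y = 0` implies `x = y = 0`. -/
def IsConical (M : Type) [AddCommMonoid M] : Prop :=
  ∀ x y : M, x + y = 0 → x = 0 ∧ y = 0

/-- The Riesz refinement property. -/
def IsRefinement (M : Type) [AddCommMonoid M] : Prop :=
  ∀ a b c d : M, a + b = c + d →
    ∃ w x y z : M, a = w + x ∧ b = y + z ∧ c = w + y ∧ d = x + z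

/-- A prime element: not invertible, and `p ≤ a + b` implies `p ≤ a` or `p ≤ b`. -/
def IsPrimeElem {M : Type} [AddCommMonoid M] (p : M) : Prop :=
  (∀ q : M, p + q ≠ 0) ∧ ∀ a b : M, algLE p (a + b) → algLE p a ∨ algLE p b

/-- A free element: `n • p ≤ m • p` implies `n ≤ m`. -/
def IsFreeElem {M : Type} [AddCommMonoid M] (p : M) : Prop :=
  ∀ n m : ℕ, algLE (n • p) (m • p) → n ≤ m

/-- A regular element: `2x ≤ x`. -/
def IsRegularElem {M : Type} [AddCommMonoid M] (x : M) : Prop :=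
  algLE (x + x) x

/-- `q̄ < p̄` in the poset of (classes of) elements: `q ≤ p` and `p ≰ q`. -/
def classLT {M : Type} [AddCommMonoid M] (q p : M) : Prop :=
  algLE q p ∧ ¬ algLE p q

/-- `q` is a prime whose class lies in the lower cover of the class of the prime `p`:
`q̄ < p̄` and no prime class lies strictly between. -/
def InLowerCover {M : Type} [AddCommMonoid M] (p q : M) : Prop :=
  IsPrimeElem q ∧ classLT q p ∧
    ¬ ∃ t : M, IsPrimeElem t ∧ classLT q t ∧ classLT t p

/-- `Q` is a (finite) set of representatives of the classes in the lower cover of `p̄`: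
its elements are in the lower cover, pairwise inequivalent, and every prime in the
lower cover is equivalent to one of them. -/
def IsLowerCoverReps {M : Type} [AddCommMonoid M] (p : M) (Q : Finset M) : Prop :=
  (∀ q ∈ Q, InLowerCover p q) ∧
  (∀ q ∈ Q, ∀ q' ∈ Q, algLE q q' → algLE q' q → q = q') ∧
  (∀ t : M, InLowerCover p t → ∃ q ∈ Q, algLE q t ∧ algLE t q)

/-- The underlying set of the group `G'_p = {p + α : α ∈ M, p + α ≤ p}`. -/
def GpSet {M : Type} [AddCommMonoid M] (p : M) : Set M :=
  {y | ∃ α : M, y = p + α ∧ algLE y p}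

/-- `j : G' → M` realizes the abelian group `G'` as the group
`G'_p = {p + α : p + α ≤ p}` with identity `p` and operation
`(p + α) ∘ (p + β) = p + (α + β)`. -/
structure GpStructure (M : Type) [AddCommMonoid M] (p : M)
    (G' : Type) [AddCommGroup G'] (j : G' → M) : Prop where
  inj : Function.Injective j
  range_eq : Set.range j = GpSet p
  map_zero : j 0 = p
  map_add : ∀ (u v : G') (α β : M), j u = p + α → j v = p + β → j (u + v) = p + (α + β)

/-- The archimedean component of `s`: all `a` with `a ≤ n • s` and `s ≤ m • a` for
some positive integers `n, m`; it is a subsemigroup. -/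
def archComp {M : Type} [AddCommMonoid M] (s : M) : AddSubsemigroup M where
  carrier := {a : M | ∃ n m : ℕ, 0 < n ∧ 0 < m ∧ algLE a (n • s) ∧ algLE s (m • a)}
  add_mem' := by
    rintro a b ⟨n, m, hn, hm, ⟨z, hz⟩, ⟨w, hw⟩⟩ ⟨n', m', hn', hm', ⟨z', hz'⟩, ⟨w', hw'⟩⟩
    refine ⟨n + n', m, Nat.add_pos_left hn _, hm, ⟨z + z', ?_⟩, ⟨w + m • b, ?_⟩⟩
    · rw [add_nsmul, hz, hz']; abel
    · rw [nsmul_add, hw]; abel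

/-- `(Γ, ι)` is a Grothendieck group of the commutative semigroup `S`: every
semigroup homomorphism from `S` to an abelian group factors uniquely through `ι`. -/
def IsGrothendieck (S : Type) [Add S] (Γ : Type) [AddCommGroup Γ] (ι : AddHom S Γ) : Prop :=
  ∀ (A : Type) [AddCommGroup A], ∀ f : AddHom S A, ∃! g : Γ →+ A, ∀ x : S, g (ι x) = f x

/-- The almost-isomorphism condition at a free prime `p`, with `Q` a set of
representatives of the lower cover of `p̄`, and `s_p = Σ_{q ∈ Q} q`: for every
Grothendieck group `ι : M_{J_p} → Γ` of the archimedean component `M_{J_p}` of `s_p`,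
every realization `(G', j)` of the group `G'_p`, every incarnation
`φp : M_{J_p} → G'` of the map `x ↦ p + x`, the unique group homomorphism
`ψ = G(φ_p) : Γ → G'` with `ψ ∘ ι = φp` is surjective and its kernel is the cyclic
subgroup generated by `ι x` for some `x ∈ M_{J_p}`. -/
def AlmostIsoCondition (M : Type) [AddCommMonoid M] (p : M) (Q : Finset M) : Prop :=
  ∀ (Γ : Type) [AddCommGroup Γ],
    ∀ ι : AddHom (archComp (∑ q ∈ Q, (q : M))) Γ,
    IsGrothendieck (archComp (∑ q ∈ Q, (q : M))) Γ ι →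
    ∀ (G' : Type) [AddCommGroup G'], ∀ j : G' → M, GpStructure M p G' j →
    ∀ φp : AddHom (archComp (∑ q ∈ Q, (q : M))) G',
      (∀ a : archComp (∑ q ∈ Q, (q : M)), j (φp a) = p + (a : M)) →
    ∀ ψ : Γ →+ G', (∀ a, ψ (ι a) = φp a) →
      Function.Surjective ψ ∧
        ∃ x : archComp (∑ q ∈ Q, (q : M)), ψ.ker = AddSubgroup.zmultiples (ι x)

/-- An order-ideal of a commutative monoid. -/
def IsOrderIdeal {M : Type} [AddCommMonoid M] (S : Set M) : Prop :=
  (0 : M) ∈ S ∧ (∀ x y : M, x ∈ S → y ∈ S → x + y ∈ S) ∧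
    ∀ x y : M, algLE x y → y ∈ S → x ∈ S

/-- The order-ideal generated by a subset: the smallest order-ideal containing it. -/
def orderIdealGen {M : Type} [AddCommMonoid M] (X : Set M) : Set M :=
  ⋂₀ {S : Set M | IsOrderIdeal S ∧ X ⊆ S}

/-- The restriction graph `E_H` of a hereditary subset `H` of the vertices. -/
def restrictGraph (G : RowFiniteGraph) (H : Set G.V)
    (hher : ∀ e : G.E, G.s e ∈ H → G.r e ∈ H) : RowFiniteGraph where
  V := ↥H
  E := {e : G.E // G.s e ∈ H}
  countableV := by have := G.countableV; exact inferInstance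
  countableE := by have := G.countableE; exact inferInstance
  s := fun e => ⟨G.s e.1, e.2⟩
  r := fun e => ⟨G.r e.1, hher e.1 e.2⟩
  rowFinite := fun v => by
    have hsub : {e : {e : G.E // G.s e ∈ H} | (⟨G.s e.1, e.2⟩ : ↥H) = v}
        ⊆ Subtype.val ⁻¹' {e : G.E | G.s e = (v : G.V)} := by
      intro e he
      simpa [Subtype.ext_iff] using he
    exact Set.Finite.subset
      (Set.Finite.preimage (Subtype.val_injective.injOn) (G.rowFinite (v : G.V))) hsub

/-- The graph with one loop at each vertex `v` and, in addition, `R v w` edges from `v` to `w`. -/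
def loopGraph (V : Type) [Finite V] (R : V → V → ℕ) : RowFiniteGraph where
  V := V
  E := Σ v : V, Option (Σ w : V, Fin (R v w))
  countableV := inferInstance
  countableE := inferInstance
  s := Sigma.fst
  r := fun e => e.2.elim e.1 Sigma.fst
  rowFinite := fun _ => Set.toFinite _

/-- The defining relations of the graph monoid of `loopGraph V R`. -/
def loopRel {V : Type} [Finite V] (R : V → V → ℕ) (x y : V →₀ ℕ) : Prop :=
  ∃ v : V, x = Finsupp.single v 1 ∧
    y = Finsupp.single v 1 + Finsupp.equivFunOnFinite.symm (R v)

theorem graphRel_loopGraph {V : Type} [Fintype V] (R : V → V → ℕ) :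
    graphRel (loopGraph V R) = loopRel R := by
  have sum_edges : ∀ v : V, ∑ e ∈ ((loopGraph V R).rowFinite v).toFinset,
      Finsupp.single ((loopGraph V R).r e) 1 =
        (Finsupp.single v 1 + Finsupp.equivFunOnFinite.symm (R v) : V →₀ ℕ) := by
    intro v
    have h : ((loopGraph V R).rowFinite v).toFinset = (Finset.univ :
        Finset (Option (Σ w : V, Fin (R v w)))).map (Function.Embedding.sigmaMk v) := by
      ext ⟨w, e⟩
      refine (Set.Finite.mem_toFinset _).trans ⟨?_, fun h => ?_⟩
      · rintro h
        obtain rfl : w = v := h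
        exact Finset.mem_map.2 ⟨e, Finset.mem_univ _, rfl⟩
      · obtain ⟨a, -, ha⟩ := Finset.mem_map.1 h
        exact (congrArg Sigma.fst ha).symm
    rw [h]
    refine (Finset.sum_map _ _ _).trans ((Fintype.sum_option _).trans ?_)
    refine congrArg ((Finsupp.single v 1 : V →₀ ℕ) + ·) ((Fintype.sum_sigma _).trans ?_)
    change (∑ w : V, ∑ _ : Fin (R v w), Finsupp.single w 1 : V →₀ ℕ) =
      Finsupp.equivFunOnFinite.symm (R v)
    simpa using Finsupp.univ_sum_single (Finsupp.equivFunOnFinite.symm (R v))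
  funext x y
  refine propext ⟨?_, ?_⟩
  · rintro ⟨v, -, hx, hy⟩
    exact ⟨v, hx, hy.trans (sum_edges v)⟩
  · rintro ⟨v, hx, hy⟩
    exact ⟨v, ⟨⟨v, none⟩, rfl⟩, hx, hy.trans (sum_edges v).symm⟩

/-- The homomorphism from a free commutative monoid to `H⁰` sending each generator `v` to the
element `val v` of `H`. -/
noncomputable def liftWithZero {V H : Type} [AddCommGroup H] (val : V → H) :
    (V →₀ ℕ) →+ WithZero H := by
  classical
  exact
  { toFun := fun x => if x = 0 then 0 else ((x.sum fun v n => n • val v : H) : WithZero H)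
    map_zero' := if_pos rfl
    map_add' := fun x y => by
      by_cases hx : x = 0
      · simp [hx]
      by_cases hy : y = 0
      · simp [hy]
      have hxy : x + y ≠ 0 := fun h => hx (add_eq_zero.1 h).1
      simp only [hx, hy, hxy, if_false]
      rw [Finsupp.sum_add_index' (by simp) (by simp [add_nsmul]), WithZero.coe_add] }

theorem liftWithZero_of_ne_zero {V H : Type} [Fintype V] [AddCommGroup H] (val : V → H)
    {x : V →₀ ℕ} (hx : x ≠ 0) :
    liftWithZero val x = ((∑ v, x v • val v : H) : WithZero H) := by
  simp [liftWithZero, hx, Finsupp.sum_fintype]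

theorem liftWithZero_eq_zero_iff {V H : Type} [AddCommGroup H] (val : V → H)
    {x : V →₀ ℕ} : liftWithZero val x = 0 ↔ x = 0 := by
  constructor
  · intro h
    by_contra hx
    simp [liftWithZero, hx] at h
  · rintro rfl
    exact map_zero _

section LoopGraph

variable {V : Type} [Fintype V] {R : V → V → ℕ}

theorem loopGraph_absorb (hR : ∀ v w, 0 < R v w) {x : V →₀ ℕ} (hx : x ≠ 0) (v : V) :
    (addConGen (loopRel R)).mk' (x + Finsupp.equivFunOnFinite.symm (R v)) =
      (addConGen (loopRel R)).mk' x := by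
  set π := (addConGen (loopRel R)).mk'
  set ρ : V → V →₀ ℕ := fun v => Finsupp.equivFunOnFinite.symm (R v)
  have vertex : ∀ w, π (Finsupp.single w 1) + π (ρ w) = π (Finsupp.single w 1) := fun w => by
    rw [← map_add]
    exact ((AddCon.eq _).2 (AddConGen.Rel.of _ _ ⟨w, rfl, rfl⟩)).symm
  have of_le : ∀ (y : V →₀ ℕ) (w : V), 0 < y w → π y + π (ρ w) = π y := fun y w hw => by
    have hle : Finsupp.single w 1 ≤ y := Finsupp.single_le_iff.2 hw
    obtain ⟨z, rfl⟩ := exists_add_of_le hle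
    rw [map_add, add_right_comm, vertex]
  obtain ⟨w, hw⟩ := Finsupp.ne_iff.1 hx
  have hxw := of_le x w (Nat.pos_of_ne_zero hw)
  change π (x + ρ v) = π x
  rw [map_add, ← hxw, add_assoc, of_le (ρ w) v (hR w v)]

theorem loopGraph_absorb_sum (hR : ∀ v w, 0 < R v w) {x : V →₀ ℕ} (hx : x ≠ 0) (c : V → ℕ) :
    (addConGen (loopRel R)).mk'
        (x + ∑ v, c v • Finsupp.equivFunOnFinite.symm (R v)) =
      (addConGen (loopRel R)).mk' x := by
  have multiple : ∀ (n : ℕ) (y : V →₀ ℕ) (v : V), y ≠ 0 →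
      (addConGen (loopRel R)).mk' (y + n • Finsupp.equivFunOnFinite.symm (R v)) =
      (addConGen (loopRel R)).mk' y := by
    intro n y v hy
    induction n with
    | zero => simp
    | succ n ih =>
      rw [succ_nsmul, ← add_assoc, loopGraph_absorb hR (fun h => hy (add_eq_zero.1 h).1), ih]
  classical
  induction (Finset.univ : Finset V) using Finset.induction_on with
  | empty => simp
  | insert v s hv ih =>
    rw [Finset.sum_insert hv, add_left_comm, add_comm,
      multiple _ _ _ (fun h => hx (add_eq_zero.1 h).1), ih]

/-- If the rows of a positive square matrix `R` generate the relations among generators `val` of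
an abelian group `H`, then the graph monoid of `loopGraph V R` is `H⁰`. -/
theorem nonempty_graphMonoid_loopGraph_equiv [Nonempty V] {H : Type} [AddCommGroup H]
    (val : V → H) (hR : ∀ v w, 0 < R v w)
    (hgen : ∀ h : H, ∃ z : V → ℤ, ∑ v, z v • val v = h)
    (hrel : ∀ v, ∑ w, R v w • val w = 0)
    (hker : ∀ z : V → ℤ, ∑ v, z v • val v = 0 → ∃ c : V → ℤ, ∀ w, z w = ∑ v, c v * R v w) :
    Nonempty (graphMonoid (loopGraph V R) ≃+ WithZero H) := by
  classical
  have hle : addConGen (loopRel R) ≤ AddCon.ker (liftWithZero val) := by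
    refine AddCon.addConGen_le.2 fun x y hxy => ?_
    obtain ⟨v, rfl, rfl⟩ := hxy
    have h1 : (Finsupp.single v 1 : V →₀ ℕ) ≠ 0 := by simp
    have h2 : (Finsupp.single v 1 + Finsupp.equivFunOnFinite.symm (R v) : V →₀ ℕ) ≠ 0 :=
      fun h => h1 (add_eq_zero.1 h).1
    rw [AddCon.ker_rel, liftWithZero_of_ne_zero val h1, liftWithZero_of_ne_zero val h2]
    simp [add_nsmul, Finset.sum_add_distrib, hrel]
  suffices h : Nonempty ((addConGen (loopRel R)).Quotient ≃+ WithZero H) by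
    obtain ⟨e⟩ := h
    exact ⟨(AddCon.congr (AddEquiv.refl _)
      (congrArg addConGen (graphRel_loopGraph R))).trans e⟩
  refine ⟨AddEquiv.ofBijective (AddCon.lift _ (liftWithZero val) hle :
    (addConGen (loopRel R)).Quotient →+ WithZero H) ⟨?_, ?_⟩⟩
  · intro a b
    induction a, b using AddCon.induction_on₂ with
    | H x y =>
    intro hxy
    change liftWithZero val x = liftWithZero val y at hxy
    by_cases hx : x = 0
    · subst hx
      rw [map_zero, eq_comm, liftWithZero_eq_zero_iff] at hxy
      rw [hxy]
    by_cases hy : y = 0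
    · subst hy
      rw [map_zero, liftWithZero_eq_zero_iff] at hxy
      rw [hxy]
    rw [liftWithZero_of_ne_zero val hx, liftWithZero_of_ne_zero val hy, WithZero.coe_inj] at hxy
    obtain ⟨c, hc⟩ := hker (fun v => (x v : ℤ) - y v) (by
      simp [sub_smul, Finset.sum_sub_distrib, hxy])
    have key : x + ∑ v, (c v).natAbs • Finsupp.equivFunOnFinite.symm (R v) =
        y + ∑ v, (c v + |c v|).toNat • Finsupp.equivFunOnFinite.symm (R v) := by
      ext w
      have hw := hc w
      have hnn : ∀ v, (((c v + |c v|).toNat : ℕ) : ℤ) = c v + |c v| :=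
        fun v => Int.toNat_of_nonneg (by linarith [neg_abs_le (c v)])
      rw [Finsupp.add_apply, Finsupp.add_apply, Finsupp.finsetSum_apply, Finsupp.finsetSum_apply]
      simp only [Finsupp.smul_apply, smul_eq_mul, Finsupp.equivFunOnFinite_symm_apply_apply]
      zify
      simp only [hnn, add_mul, Finset.sum_add_distrib]
      linarith
    have hx' := loopGraph_absorb_sum hR hx fun v => (c v).natAbs
    have hy' := loopGraph_absorb_sum hR hy fun v => (c v + |c v|).toNat
    exact hx'.symm.trans ((congrArg _ key).trans hy')
  · intro h
    induction h with
    | zero => exact ⟨0, map_zero _⟩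
    | coe h =>
      obtain ⟨z, hz⟩ := hgen h
      obtain ⟨v₀⟩ := ‹Nonempty V›
      let N : ℕ := 1 + ∑ v, (z v).natAbs
      have hpos : ∀ w, 0 < z w + N * R v₀ w := fun w => by
        have h1 : (z w).natAbs ≤ ∑ v, (z v).natAbs :=
          Finset.single_le_sum (f := fun v => (z v).natAbs) (by simp) (Finset.mem_univ w)
        have h2 : N ≤ N * R v₀ w := Nat.le_mul_of_pos_right _ (hR v₀ w)
        zify at h2
        simp only [N] at h2 ⊢
        omega
      let x : V →₀ ℕ := Finsupp.equivFunOnFinite.symm fun w => (z w + N * R v₀ w).toNat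
      have hxw : ∀ w, (x w : ℤ) = z w + N * R v₀ w := fun w => Int.toNat_of_nonneg (hpos w).le
      have hx : x ≠ 0 := fun h => by
        have := hxw v₀
        have := hpos v₀
        simp_all
      refine ⟨((x : V →₀ ℕ) : (addConGen (loopRel R)).Quotient), ?_⟩
      change liftWithZero val x = h
      rw [liftWithZero_of_ne_zero val hx, WithZero.coe_inj, ← hz]
      have hN : ∑ w, ((N : ℤ) * R v₀ w) • val w = 0 := by
        simp only [mul_smul, natCast_zsmul, ← Finset.smul_sum, hrel, smul_zero]
      simp only [← natCast_zsmul, hxw, add_smul, Finset.sum_add_distrib, hN, add_zero]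

end LoopGraph

/-- A finitely generated abelian group has a finite presentation with as many relations as
generators. -/
theorem exists_square_presentation (H : Type) [AddCommGroup H] [AddGroup.FG H] :
    ∃ (k : ℕ) (f : Fin k → H) (r : Fin k → Fin k → ℤ),
      (∀ h, ∃ z : Fin k → ℤ, ∑ i, z i • f i = h) ∧ (∀ i, ∑ j, r i j • f j = 0) ∧
      ∀ z : Fin k → ℤ, ∑ i, z i • f i = 0 → ∃ c : Fin k → ℤ, ∀ j, z j = ∑ i, c i * r i j := by
  have : Module.Finite ℤ H := Module.Finite.iff_addGroup_fg.2 inferInstance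
  obtain ⟨k, f, hf⟩ := Module.Finite.exists_fin (R := ℤ) (M := H)
  let φ : (Fin k → ℤ) →ₗ[ℤ] H := Fintype.linearCombination ℤ f
  have hφ : ∀ z, φ z = ∑ i, z i • f i := Fintype.linearCombination_apply ℤ f
  obtain ⟨m, b⟩ := Submodule.basisOfPid (Pi.basisFun ℤ (Fin k)) φ.ker
  have hm : m ≤ k := by
    have h := Submodule.finrank_le φ.ker
    rwa [Module.finrank_eq_card_basis b, Module.finrank_fin_fun, Fintype.card_fin] at h
  let r : Fin k → φ.ker := fun i => if h : i.1 < m then b ⟨i, h⟩ else 0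
  refine ⟨k, f, fun i => (r i).1, fun h => ?_, fun i => ?_, fun z hz => ?_⟩
  · have hh : h ∈ Submodule.span ℤ (Set.range f) := hf ▸ Submodule.mem_top
    exact (Submodule.mem_span_range_iff_exists_fun ℤ).1 hh
  · rw [← hφ]
    exact (r i).2
  · have hspan : (⟨z, (hφ z).trans hz⟩ : φ.ker) ∈ Submodule.span ℤ (Set.range r) := by
      have htop : Submodule.span ℤ (Set.range r) = ⊤ := by
        rw [eq_top_iff, ← b.span_eq]
        refine Submodule.span_mono ?_
        rintro _ ⟨i, rfl⟩
        exact ⟨⟨i, i.2.trans_le hm⟩, by simp [r]⟩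
      exact htop ▸ Submodule.mem_top
    obtain ⟨c, hc⟩ := (Submodule.mem_span_range_iff_exists_fun ℤ).1 hspan
    refine ⟨c, fun j => ?_⟩
    have := congrFun (congrArg Subtype.val hc) j
    simpa using this.symm

/-- For every finitely generated abelian group `H` there is a
countable row-finite directed graph `E` whose graph monoid `M(E)` is isomorphic to
the monoid `H⁰` obtained from `H` by adjoining a new neutral element `0`
(so that, in particular, the nonzero elements of `M(E)` form a group isomorphic
to `H`). -/
theorem graphMonoid_of_fg_abelian_group (H : Type) [AddCommGroup H] [AddGroup.FG H] :
    ∃ G : RowFiniteGraph, Nonempty (graphMonoid G ≃+ WithZero H) := by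
  obtain ⟨k, f, r, hgen, hrel, hker⟩ := exists_square_presentation H
  let N : Fin k → ℕ := fun i => 1 + ∑ j, (r i j).natAbs
  have hpos : ∀ i j, 0 < r i j + N i := fun i j => by
    have : (r i j).natAbs ≤ ∑ j, (r i j).natAbs :=
      Finset.single_le_sum (f := fun j => (r i j).natAbs) (by simp) (Finset.mem_univ j)
    simp only [N]
    omega
  let R : Option (Fin k) → Option (Fin k) → ℕ := fun v w =>
    v.elim 1 fun i => w.elim (N i) fun j => (r i j + N i).toNat
  have hsome : ∀ i j, (R (some i) (some j) : ℤ) = r i j + N i := fun i j =>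
    Int.toNat_of_nonneg (hpos i j).le
  let val : Option (Fin k) → H := fun v => v.elim (-∑ i, f i) f
  refine ⟨loopGraph (Option (Fin k)) R,
    nonempty_graphMonoid_loopGraph_equiv val ?_ ?_ ?_ ?_⟩
  · rintro (_ | i) (_ | j)
    · exact one_pos
    · exact one_pos
    · exact Nat.add_pos_left one_pos _
    · have := hpos i j
      have := hsome i j
      omega
  · intro h
    obtain ⟨z, hz⟩ := hgen h
    refine ⟨fun v => v.elim 0 z, ?_⟩
    simpa [Fintype.sum_option, val] using hz
  · rintro (_ | i)
    · simp [Fintype.sum_option, val, R]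
    · simp only [← natCast_zsmul, Fintype.sum_option, hsome, add_smul, Finset.sum_add_distrib]
      simp [val, R, hrel, ← Finset.smul_sum]
  · intro z hz
    obtain ⟨c, hc⟩ := hker (fun i => z (some i) - z none) (by
      rw [Fintype.sum_option] at hz
      simp only [sub_smul, Finset.sum_sub_distrib, ← Finset.smul_sum]
      simpa [val, add_comm, sub_eq_add_neg] using hz)
    refine ⟨fun v => v.elim (z none - ∑ i, c i * N i) c, ?_⟩
    rintro (_ | j)
    · simp [Fintype.sum_option, R]
    · have := hc j
      simp only [Fintype.sum_option, hsome, mul_add, Finset.sum_add_distrib, Option.elim]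
      simp only [R, Option.elim, Nat.cast_one, mul_one]
      linarith

end ArPardo
end

section
/- Let φ : H → G be a homomorphism between finitely generated abelian groups. Then the conical regular refinement monoid M(φ) is a graph monoid: there exists a countable row-finite directed graph E with M(φ) ≅ M(E). -/
namespace ArPardo

/-- The graph with vertex set `V` in which the edges leaving `v` are indexed by the entries of the
list `s v`, each edge ending at the corresponding entry. -/
abbrev listGraph (V : Type) [Countable V] (s : V → List V) : RowFiniteGraph where
  V := V
  E := Σ v : V, Fin (s v).length
  countableV := inferInstance
  countableE := inferInstance
  s := Sigma.fst
  r := fun e => (s e.1).get e.2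
  rowFinite := fun v => by
    refine (Set.finite_range fun i : Fin (s v).length =>
      (⟨v, i⟩ : Σ v : V, Fin (s v).length)).subset ?_
    rintro ⟨w, i⟩ rfl
    exact ⟨i, rfl⟩

section ListGraph

variable {V : Type} [Countable V] {s : V → List V}

theorem listGraph_sum_edges (v : V) :
    ∑ e ∈ ((listGraph V s).rowFinite v).toFinset,
      (Finsupp.single ((listGraph V s).r e) 1 : V →₀ ℕ) =
      ((s v).map fun u => Finsupp.single u 1).sum := by
  rw [← Fin.sum_univ_fun_getElem]
  symm
  refine Finset.sum_bij (fun i _ => (⟨v, i⟩ : Σ v : V, Fin (s v).length)) ?_ ?_ ?_ ?_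
  · intro i _
    rw [Set.Finite.mem_toFinset]
    rfl
  · intro i _ j _ h
    exact eq_of_heq (Sigma.mk.inj h).2
  · rintro ⟨w, i⟩ h
    rw [Set.Finite.mem_toFinset] at h
    obtain rfl : w = v := h
    exact ⟨i, Finset.mem_univ _, rfl⟩
  · intro i _
    rfl

variable (s) in
/-- The sum of the generators of `graphMonoid (listGraph V s)` along a list of vertices. -/
noncomputable def vertexSum (l : List V) : graphMonoid (listGraph V s) :=
  (l.map (vertexElem (listGraph V s))).sum

@[simp]
theorem vertexSum_nil : vertexSum s [] = 0 := rfl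

@[simp]
theorem vertexSum_cons (v : V) (l : List V) :
    vertexSum s (v :: l) = vertexElem (listGraph V s) v + vertexSum s l := by
  simp [vertexSum]

@[simp]
theorem vertexSum_append (l m : List V) :
    vertexSum s (l ++ m) = vertexSum s l + vertexSum s m := by
  simp [vertexSum]

theorem vertexSum_eq_mk (l : List V) :
    vertexSum s l = (addConGen (graphRel (listGraph V s))).mk'
      (l.map fun u => (Finsupp.single u 1 : V →₀ ℕ)).sum := by
  induction l with
  | nil => exact (map_zero (addConGen (graphRel (listGraph V s))).mk').symm
  | cons v l ih =>
    rw [vertexSum_cons, ih, List.map_cons, List.sum_cons]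
    exact (map_add (addConGen (graphRel (listGraph V s))).mk' _ _).symm

theorem vertexElem_eq_vertexSum {v : V} (hv : s v ≠ []) :
    vertexElem (listGraph V s) v = vertexSum s (s v) := by
  rw [vertexSum_eq_mk, ← listGraph_sum_edges]
  exact (AddCon.eq _).2 (AddConGen.Rel.of _ _
    ⟨v, ⟨⟨v, ⟨0, List.length_pos_iff.2 hv⟩⟩, rfl⟩, rfl, rfl⟩)

theorem exists_vertexSum_eq (p : graphMonoid (listGraph V s)) : ∃ l, vertexSum s l = p := by
  obtain ⟨x, rfl⟩ := AddCon.mk'_surjective (c := addConGen (graphRel (listGraph V s))) p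
  have key : ∀ x : V →₀ ℕ, ∃ l : List V, (l.map fun u => (Finsupp.single u 1 : V →₀ ℕ)).sum = x := by
    intro x
    refine Finsupp.induction_linear x ⟨[], rfl⟩ ?_ ?_
    · rintro _ _ ⟨l, rfl⟩ ⟨m, rfl⟩
      exact ⟨l ++ m, by simp⟩
    · intro v n
      exact ⟨List.replicate n v, by simp⟩
  obtain ⟨l, rfl⟩ := key x
  exact ⟨l, vertexSum_eq_mk l⟩

/-- A labelling of the vertices by elements of `M` that satisfies the graph relations extends
to the graph monoid. -/
theorem exists_hom_vertexSum {M : Type} [AddCommMonoid M] (c : V → M)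
    (hc : ∀ v, c v = ((s v).map c).sum) :
    ∃ F : graphMonoid (listGraph V s) →+ M, ∀ l, F (vertexSum s l) = (l.map c).sum := by
  let F₀ : (V →₀ ℕ) →+ M := Finsupp.liftAddHom fun v => (multiplesHom M) (c v)
  have hF₀ : ∀ l : List V, F₀ (l.map fun u => Finsupp.single u 1).sum = (l.map c).sum := by
    intro l
    rw [map_list_sum, List.map_map]
    congr 2
    ext v
    simp [F₀]
  have hle : addConGen (graphRel (listGraph V s)) ≤ AddCon.ker F₀ := by
    refine AddCon.addConGen_le.2 ?_
    rintro x y ⟨v, -, rfl, rfl⟩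
    have h₁ := hF₀ [v]
    have h₂ := hF₀ (s v)
    rw [← listGraph_sum_edges] at h₂
    simp only [List.map_cons, List.map_nil, List.sum_cons, List.sum_nil, add_zero] at h₁
    exact (h₁.trans (hc v)).trans h₂.symm
  refine ⟨AddCon.lift _ F₀ hle, fun l => ?_⟩
  rw [vertexSum_eq_mk, ← hF₀]
  rfl

end ListGraph

section Absorption

variable {M : Type} [AddCommMonoid M]

theorem algLE.trans {x y z : M} (hxy : algLE x y) (hyz : algLE y z) : algLE x z := by
  obtain ⟨u, rfl⟩ := hxy
  obtain ⟨w, rfl⟩ := hyz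
  exact ⟨u + w, add_assoc _ _ _⟩

theorem algLE.add {x y z w : M} (hxy : algLE x y) (hzw : algLE z w) :
    algLE (x + z) (y + w) := by
  obtain ⟨u, rfl⟩ := hxy
  obtain ⟨t, rfl⟩ := hzw
  exact ⟨u + t, add_add_add_comm _ _ _ _⟩

theorem algLE.add_eq_self {x y m : M} (hxy : algLE x y) (h : x + m = x) : y + m = y := by
  obtain ⟨u, rfl⟩ := hxy
  rw [add_right_comm, h]

theorem IsRegularElem.exists_inverse (hcon : IsConical M) {x : M} (hx : IsRegularElem x)
    (hx0 : x ≠ 0) : ∃ y, y ≠ 0 ∧ x + (x + y) = x := by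
  obtain ⟨w, hw⟩ := hx
  refine ⟨x + (w + w), fun h => hx0 (hcon _ _ h).1, ?_⟩
  calc x + (x + (x + (w + w))) = (x + x + w) + x + w := by abel
    _ = x := by rw [← hw, ← hw]

/-- If `algLE` is total and all elements are regular, every nonempty sum is bounded by one of
its terms. -/
theorem exists_mem_sum_algLE (hreg : ∀ x : M, IsRegularElem x)
    (htot : ∀ x y : M, algLE x y ∨ algLE y x) {ι : Type} (c : ι → M) (l : List ι)
    (hl : l ≠ []) : ∃ v ∈ l, algLE (l.map c).sum (c v) := by
  induction l with
  | nil => exact absurd rfl hl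
  | cons v l ih =>
    rw [List.map_cons, List.sum_cons]
    by_cases hl' : l = []
    · subst hl'
      exact ⟨v, by simp, 0, by simp⟩
    · obtain ⟨w, hw, hlw⟩ := ih hl'
      rcases htot (c v) (c w) with h | h
      · exact ⟨w, List.mem_cons_of_mem _ hw, (h.add hlw).trans (hreg _)⟩
      · exact ⟨v, List.mem_cons_self, (algLE.add ⟨0, by simp⟩ (hlw.trans h)).trans (hreg _)⟩

theorem vertexElem_algLE_vertexSum {V : Type} [Countable V] {s : V → List V} {v : V}
    {l : List V} (h : v ∈ l) : algLE (vertexElem (listGraph V s) v) (vertexSum s l) := by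
  obtain ⟨l₁, l₂, rfl⟩ := List.append_of_mem h
  exact ⟨vertexSum s l₁ + vertexSum s l₂, by simp [add_left_comm]⟩

end Absorption

section TotallyOrdered

variable {M : Type} [AddCommMonoid M]

/-- The vertices labelled by the nonzero element `x` are the triples `(x, n, b)`. -/
abbrev LabelVertex (M : Type) [AddCommMonoid M] : Type := {x : M // x ≠ 0} × ℕ × Bool

/-- The sum of the labels along a list of vertices. -/
def labelSum (l : List (LabelVertex M)) : M := (l.map fun v => (v.1 : M)).sum

/-- Edges from level `n` to level `n + 1`, with labels `x` and `i x`. -/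
def levelList (i : {x : M // x ≠ 0} → {x : M // x ≠ 0}) (x : {x : M // x ≠ 0}) (n : ℕ) :
    List (LabelVertex M) :=
  [(x, n + 1, true), (x, n + 1, false), (i x, n + 1, true), (i x, n + 1, false)]

open Classical in
/-- The list of targets of the edges leaving a vertex: a loop, the edges to the next level, and
at the vertices `(x, n, true)` the `n`-th list `q n`, provided `x` absorbs its label sum. -/
noncomputable def targetList (i : {x : M // x ≠ 0} → {x : M // x ≠ 0})
    (q : ℕ → List (LabelVertex M)) (v : LabelVertex M) : List (LabelVertex M) :=
  v :: (levelList i v.1 v.2.1 ++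
    if v.2.2 = true ∧ (v.1 : M) + labelSum (q v.2.1) = v.1 then q v.2.1 else [])

theorem label_eq_targetList_sum {i : {x : M // x ≠ 0} → {x : M // x ≠ 0}}
    (hi : ∀ x : {x : M // x ≠ 0}, (x : M) + (x + i x) = x) (q : ℕ → List (LabelVertex M)) (v : LabelVertex M) :
    (v.1 : M) = ((targetList i q v).map fun v => (v.1 : M)).sum := by
  obtain ⟨x, n, b⟩ := v
  have h : (x : M) + labelSum (levelList i x n) = x := by
    calc (x : M) + labelSum (levelList i x n) = x + (x + i x) + (x + i x) := by
          simp only [labelSum, levelList, List.map_cons, List.map_nil, List.sum_cons, List.sum_nil]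
          abel
      _ = x := by rw [hi, hi]
  rw [targetList, List.map_cons, List.map_append, List.sum_cons, List.sum_append, ← add_assoc]
  change (x : M) = x + labelSum (levelList i x n) + _
  rw [h]
  split_ifs with hq
  · exact hq.2.symm
  · simp

theorem eq_nil_of_labelSum_eq_zero (hcon : IsConical M) {l : List (LabelVertex M)}
    (h : labelSum l = 0) : l = [] := by
  cases l with
  | nil => rfl
  | cons v l => exact absurd (hcon _ _ h).1 v.1.2

variable [Countable M] {i : {x : M // x ≠ 0} → {x : M // x ≠ 0}}
  {q : ℕ → List (LabelVertex M)}

local notation "gen" => vertexElem (listGraph (LabelVertex M) (targetList i q))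

local notation "vsum" => vertexSum (targetList i q)

theorem vertexElem_eq_targetList (v : LabelVertex M) : gen v = vsum (targetList i q v) :=
  vertexElem_eq_vertexSum (by simp [targetList])

theorem vertexElem_level_algLE (x : {x : M // x ≠ 0}) {n N : ℕ} (h : n < N) (b b' : Bool) :
    algLE (gen (x, N, b')) (gen (x, n, b)) := by
  have step : ∀ (n : ℕ) (b b' : Bool), algLE (gen (x, n + 1, b')) (gen (x, n, b)) := by
    intro n b b'
    rw [vertexElem_eq_targetList (x, n, b)]
    exact vertexElem_algLE_vertexSum (by cases b' <;> simp [targetList, levelList])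
  induction N, h using Nat.le_induction generalizing b' with
  | base => exact step n b b'
  | succ N _ ih => exact (step N true b').trans (ih true)

theorem vertexElem_add_of_absorbs (hq : ∀ (m : List (LabelVertex M)) (n : ℕ), ∃ N > n, q N = m)
    (v : LabelVertex M) (m : List (LabelVertex M)) (hm : (v.1 : M) + labelSum m = v.1) :
    gen v + vsum m = gen v := by
  obtain ⟨x, n, b⟩ := v
  obtain ⟨N, hN, rfl⟩ := hq m n
  have h₁ : gen (x, N, false) + vsum (levelList i x N) = gen (x, N, false) := by
    conv_rhs => rw [vertexElem_eq_targetList]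
    simp [targetList]
  have h₂ : gen (x, N, true) + (vsum (levelList i x N) + vsum (q N)) = gen (x, N, true) := by
    conv_rhs => rw [vertexElem_eq_targetList]
    simp only [targetList]
    rw [if_pos ⟨rfl, hm⟩]
    simp
  have h₃ := (vertexElem_level_algLE (i := i) (q := q) x hN b false).add_eq_self h₁
  have h₄ := (vertexElem_level_algLE (i := i) (q := q) x hN b true).add_eq_self h₂
  rwa [← add_assoc, h₃] at h₄

theorem vertexSum_add_of_absorbs (hcon : IsConical M) (hreg : ∀ x : M, IsRegularElem x)
    (htot : ∀ x y : M, algLE x y ∨ algLE y x)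
    (hq : ∀ (m : List (LabelVertex M)) (n : ℕ), ∃ N > n, q N = m)
    (l m : List (LabelVertex M)) (h : labelSum l + labelSum m = labelSum l) :
    vsum l + vsum m = vsum l := by
  by_cases hl : l = []
  · subst hl
    obtain rfl := eq_nil_of_labelSum_eq_zero hcon (l := m) (by simpa [labelSum] using h)
    simp
  · obtain ⟨v, hv, hlv⟩ := exists_mem_sum_algLE hreg htot (fun v : LabelVertex M => (v.1 : M)) l hl
    exact (vertexElem_algLE_vertexSum hv).add_eq_self
      (vertexElem_add_of_absorbs hq v m (hlv.add_eq_self h))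

theorem vertexSum_eq_of_labelSum_eq (hcon : IsConical M) (hreg : ∀ x : M, IsRegularElem x)
    (htot : ∀ x y : M, algLE x y ∨ algLE y x) (hi : ∀ x : {x : M // x ≠ 0}, (x : M) + (x + i x) = x)
    (hq : ∀ (m : List (LabelVertex M)) (n : ℕ), ∃ N > n, q N = m)
    {l m : List (LabelVertex M)} (h : labelSum l = labelSum m) : vsum l = vsum m := by
  by_cases hl : labelSum l = 0
  · rw [eq_nil_of_labelSum_eq_zero hcon hl, eq_nil_of_labelSum_eq_zero hcon (h.symm.trans hl)]
  · have key : ∀ k k' : List (LabelVertex M), labelSum k = labelSum l → labelSum k' = labelSum l →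
        vsum k + (gen (i ⟨labelSum l, hl⟩, 0, true) + vsum k') = vsum k := by
      intro k k' hk hk'
      rw [← vertexSum_cons]
      refine vertexSum_add_of_absorbs hcon hreg htot hq _ _ ?_
      change labelSum k + (((i ⟨labelSum l, hl⟩ : {x : M // x ≠ 0}) : M) + labelSum k') = labelSum k
      rw [hk, hk', add_comm (Subtype.val _)]
      exact hi ⟨labelSum l, hl⟩
    rw [← key l m rfl h.symm, ← add_assoc, add_comm, add_comm (vsum l), key m l h.symm rfl]

/-- A countable conical commutative monoid all of whose elements are regular and whose
algebraic preorder is total is a graph monoid. -/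
theorem isGraphMonoid_of_total (hcon : IsConical M) (hreg : ∀ x : M, IsRegularElem x)
    (htot : ∀ x y : M, algLE x y ∨ algLE y x) : IsGraphMonoid M := by
  choose i₀ hi₀ hi using fun x : {x : M // x ≠ 0} => (hreg x).exists_inverse hcon x.2
  obtain ⟨q₀, hq₀⟩ := exists_surjective_nat (List (LabelVertex M))
  let i : {x : M // x ≠ 0} → {x : M // x ≠ 0} := fun x => ⟨i₀ x, hi₀ x⟩
  let q : ℕ → List (LabelVertex M) := fun n => q₀ n.unpair.1
  have hq : ∀ (m : List (LabelVertex M)) (n : ℕ), ∃ N > n, q N = m := by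
    intro m n
    obtain ⟨k, rfl⟩ := hq₀ m
    exact ⟨Nat.pair k (n + 1), Nat.right_le_pair k (n + 1), by simp [q]⟩
  obtain ⟨F, hF⟩ := exists_hom_vertexSum (s := targetList i q) (fun v => (v.1 : M))
    (label_eq_targetList_sum hi q)
  refine ⟨listGraph (LabelVertex M) (targetList i q),
    ⟨(AddEquiv.ofBijective F ⟨fun p p' h => ?_, fun x => ?_⟩).symm⟩⟩
  · obtain ⟨l, rfl⟩ := exists_vertexSum_eq p
    obtain ⟨m, rfl⟩ := exists_vertexSum_eq p'
    rw [hF, hF] at h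
    exact vertexSum_eq_of_labelSum_eq hcon hreg htot hi hq h
  · by_cases hx : x = 0
    · exact ⟨0, by rw [map_zero, hx]⟩
    · exact ⟨vertexSum (targetList i q) [(⟨x, hx⟩, 0, true)], (hF _).trans (add_zero x)⟩

end TotallyOrdered

theorem countable_of_addGroup_fg (A : Type) [AddCommGroup A] [AddGroup.FG A] : Countable A := by
  have : Module.Finite ℤ A := Module.Finite.iff_addGroup_fg.2 inferInstance
  obtain ⟨n, F, hF⟩ := Module.Finite.exists_fin' ℤ A
  exact hF.countable

/-- Let `φ : H → G` be a homomorphism between finitely generated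
abelian groups. Then the conical regular refinement monoid `M(φ)` — the monoid with
underlying set `{0} ⊔ H ⊔ G`, neutral element `0`, sums of two elements of `H`
(resp. `G`) computed in `H` (resp. `G`), and `h + g = φ(h) + g ∈ G` for `h ∈ H`,
`g ∈ G` — is a graph monoid.  (Here `M` ranges over all commutative monoids realizing
this addition table via a bijection `f`.) -/
theorem Mphi_isGraphMonoid (H G : Type) [AddCommGroup H] [AddCommGroup G]
    [AddGroup.FG H] [AddGroup.FG G] (φ : H →+ G)
    (M : Type) [AddCommMonoid M] (f : Option (H ⊕ G) ≃ M)
    (hzero : f none = 0)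
    (hHH : ∀ h h' : H,
      f (some (Sum.inl h)) + f (some (Sum.inl h')) = f (some (Sum.inl (h + h'))))
    (hGG : ∀ g g' : G,
      f (some (Sum.inr g)) + f (some (Sum.inr g')) = f (some (Sum.inr (g + g'))))
    (hHG : ∀ (h : H) (g : G),
      f (some (Sum.inl h)) + f (some (Sum.inr g)) = f (some (Sum.inr (φ h + g)))) :
    IsGraphMonoid M := by
  have hcountH : Countable H := countable_of_addGroup_fg H
  have hcountG : Countable G := countable_of_addGroup_fg G
  have hcount : Countable M := f.symm.injective.countable
  have hGH : ∀ (g : G) (h : H),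
      f (some (Sum.inr g)) + f (some (Sum.inl h)) = f (some (Sum.inr (φ h + g))) :=
    fun g h => (add_comm _ _).trans (hHG h g)
  have hcases : ∀ x : M, x = 0 ∨ (∃ h, x = f (some (Sum.inl h))) ∨
      ∃ g, x = f (some (Sum.inr g)) := by
    intro x
    obtain ⟨y, rfl⟩ := f.surjective x
    rcases y with _ | h | g
    · exact Or.inl hzero
    · exact Or.inr (Or.inl ⟨h, rfl⟩)
    · exact Or.inr (Or.inr ⟨g, rfl⟩)
  have hne : ∀ y, f (some y) ≠ 0 := fun y => by simp [← hzero]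
  have hzle : ∀ x : M, algLE 0 x := fun x => ⟨x, (zero_add x).symm⟩
  have hll : ∀ h h' : H, algLE (f (some (Sum.inl h))) (f (some (Sum.inl h'))) :=
    fun h h' => ⟨f (some (Sum.inl (h' - h))), by rw [hHH, add_sub_cancel]⟩
  have hrr : ∀ g g' : G, algLE (f (some (Sum.inr g))) (f (some (Sum.inr g'))) :=
    fun g g' => ⟨f (some (Sum.inr (g' - g))), by rw [hGG, add_sub_cancel]⟩
  have hlr : ∀ (h : H) (g : G), algLE (f (some (Sum.inl h))) (f (some (Sum.inr g))) :=
    fun h g => ⟨f (some (Sum.inr (g - φ h))), by rw [hHG, add_sub_cancel]⟩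
  refine isGraphMonoid_of_total ?_ ?_ ?_
  · intro x y hxy
    rcases hcases x with rfl | ⟨h, rfl⟩ | ⟨g, rfl⟩
    · exact ⟨rfl, by simpa using hxy⟩
    all_goals
      rcases hcases y with rfl | ⟨h', rfl⟩ | ⟨g', rfl⟩
      · exact absurd ((add_zero _).symm.trans hxy) (hne _)
      all_goals
        simp only [hHH, hGG, hHG, hGH] at hxy
        exact absurd hxy (hne _)
  · intro x
    rcases hcases x with rfl | ⟨h, rfl⟩ | ⟨g, rfl⟩
    · exact ⟨0, by simp⟩
    · rw [IsRegularElem, hHH]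
      exact hll _ _
    · rw [IsRegularElem, hGG]
      exact hrr _ _
  · intro x y
    rcases hcases x with rfl | ⟨h, rfl⟩ | ⟨g, rfl⟩
    · exact Or.inl (hzle y)
    all_goals rcases hcases y with rfl | ⟨h', rfl⟩ | ⟨g', rfl⟩
    · exact Or.inr (hzle _)
    · exact Or.inl (hll _ _)
    · exact Or.inl (hlr _ _)
    · exact Or.inr (hzle _)
    · exact Or.inr (hlr _ _)
    · exact Or.inl (hrr _ _)

end ArPardo
end

section
/- Let M be a finitely generated conical refinement monoid. Then M is a graph monoid if and only if for every free prime p of M which is not minimal in the poset of primes of M the following holds: for a Grothendieck group ι : M_{J_p} → G(M_{J_p}), the unique group homomorphism G(φ_p) : G(M_{J_p}) → G'_p satisfying G(φ_p) ∘ ι = φ_p is surjective and its kernel equals the cyclic subgroup of G(M_{J_p}) generated by ι(x) for some x ∈ M_{J_p} (that is, G(φ_p) is an almost isomorphism). -/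
namespace ArPardo

section Basic

variable {M : Type} [AddCommMonoid M]

theorem algLE.refl (x : M) : algLE x x := ⟨0, (add_zero x).symm⟩

theorem algLE_add_right (x y : M) : algLE x (x + y) := ⟨y, rfl⟩

theorem algLE_add_left (x y : M) : algLE x (y + x) := ⟨y, add_comm y x⟩

theorem algLE.nsmul {x y : M} (h : algLE x y) (n : ℕ) : algLE (n • x) (n • y) := by
  obtain ⟨a, rfl⟩ := h
  exact ⟨n • a, nsmul_add x a n⟩

theorem algLE_nsmul_of_le (x : M) {n m : ℕ} (h : n ≤ m) : algLE (n • x) (m • x) := by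
  obtain ⟨k, rfl⟩ := Nat.exists_eq_add_of_le h
  exact ⟨k • x, add_nsmul x n k⟩

/-- The algebraic preorder, bundled. -/
abbrev algPreorder (M : Type) [AddCommMonoid M] : Preorder M where
  le := algLE
  le_refl := algLE.refl
  le_trans _ _ _ := algLE.trans

theorem IsPrimeElem.congr {p q : M} (hp : IsPrimeElem p) (hpq : algLE p q) (hqp : algLE q p) :
    IsPrimeElem q := by
  refine ⟨fun z hz => ?_, fun a b h => ?_⟩
  · obtain ⟨y, rfl⟩ := hpq
    exact hp.1 (y + z) (by rw [← add_assoc, hz])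
  · exact (hp.2 a b (hpq.trans h)).imp hqp.trans hqp.trans

theorem IsFreeElem.congr {p q : M} (hp : IsFreeElem p) (hpq : algLE p q) (hqp : algLE q p) :
    IsFreeElem q := fun n m h => hp n m (((hpq.nsmul n).trans h).trans (hqp.nsmul m))

theorem IsFreeElem.not_two_le {p : M} (hp : IsFreeElem p) : ¬ algLE (p + p) p := fun h => by
  have := hp 2 1 (by simpa [two_nsmul] using h)
  omega

theorem IsPrimeElem.not_le_zero {p : M} (hp : IsPrimeElem p) : ¬ algLE p 0 := by
  rintro ⟨z, hz⟩
  exact hp.1 z hz.symm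

theorem IsPrimeElem.le_sum {p : M} (hp : IsPrimeElem p) {ι : Type} (s : Finset ι) (f : ι → M)
    (h : algLE p (∑ i ∈ s, f i)) : ∃ i ∈ s, algLE p (f i) := by
  classical
  induction s using Finset.induction_on with
  | empty => exact absurd (by simpa using h) hp.not_le_zero
  | insert a s ha ih =>
    rw [Finset.sum_insert ha] at h
    rcases hp.2 _ _ h with h | h
    · exact ⟨a, Finset.mem_insert_self a s, h⟩
    · obtain ⟨i, hi, h⟩ := ih h
      exact ⟨i, Finset.mem_insert_of_mem hi, h⟩

theorem IsPrimeElem.of_le_nsmul {p : M} (hp : IsPrimeElem p) {x : M} {n : ℕ}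
    (h : algLE p (n • x)) : algLE p x := by
  obtain ⟨i, -, h⟩ := hp.le_sum (Finset.range n) (fun _ => x) (by simpa using h)
  exact h

/-- A prime strictly below a prime `p` is absorbed by `p`. -/
theorem IsPrimeElem.add_le_of_classLT {p q : M} (hp : IsPrimeElem p) (h : classLT q p) :
    algLE (p + q) p := by
  obtain ⟨⟨z, hz⟩, hpq⟩ := h
  obtain ⟨w, rfl⟩ := (hp.2 q z (hz ▸ algLE.refl p)).resolve_left hpq
  exact ⟨w, hz.trans (by abel)⟩

theorem absorbed_add {p u v : M} (hu : algLE (p + u) p) (hv : algLE (p + v) p) :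
    algLE (p + (u + v)) p := by
  rw [← add_assoc]
  exact (hu.add (algLE.refl v)).trans hv

theorem absorbed_mono {p u v : M} (huv : algLE u v) (hv : algLE (p + v) p) :
    algLE (p + u) p := ((algLE.refl p).add huv).trans hv

theorem absorbed_nsmul {p u : M} (hu : algLE (p + u) p) (n : ℕ) : algLE (p + n • u) p := by
  induction n with
  | zero => simpa using algLE.refl p
  | succ n ih => rw [succ_nsmul]; exact absorbed_add ih hu

/-- The elements absorbed by `p` form an order ideal. -/
theorem isOrderIdeal_absorbed (p : M) : IsOrderIdeal {z : M | algLE (p + z) p} :=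
  ⟨by simpa using algLE.refl p, fun _ _ => absorbed_add, fun _ _ => absorbed_mono⟩

theorem absorbed_le {p u : M} (hu : algLE (p + u) p) : algLE u p :=
  (algLE_add_left u p).trans hu

/-- Absorption by `p` can be cancelled, since `p + α` has an inverse in `G'_p`. -/
theorem add_eq_of_add_add_eq {p w u v : M} (hu : p + w + u = p) (hv : p + w + v = p) :
    p + u = p + v := by
  calc p + u = p + w + v + u := by rw [hv]
    _ = p + w + u + v := by abel
    _ = p + v := by rw [hu]

/-- The order ideal of all elements bounded by a multiple of `s`. -/
theorem isOrderIdeal_le_nsmul (s : M) : IsOrderIdeal {z : M | ∃ k : ℕ, algLE z (k • s)} := by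
  refine ⟨⟨0, by simpa using algLE.refl (0 : M)⟩, ?_, ?_⟩
  · rintro x y ⟨k, hk⟩ ⟨l, hl⟩
    exact ⟨k + l, by rw [add_nsmul]; exact hk.add hl⟩
  · rintro x y hxy ⟨k, hk⟩
    exact ⟨k, hxy.trans hk⟩

theorem IsPrimeElem.regular_of_not_free (href : IsRefinement M) {p : M} (hp : IsPrimeElem p)
    (hfree : ¬ IsFreeElem p) : algLE (p + p) p := by
  have step : ∀ m : ℕ, algLE ((m + 1) • p) (m • p) → algLE (p + p) p := by
    intro m
    induction m with
    | zero =>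
      intro h
      exact absurd (by simpa using h) hp.not_le_zero
    | succ m ih =>
      intro h
      rcases Nat.eq_zero_or_pos m with rfl | hm
      · simpa [two_nsmul] using h
      apply ih
      obtain ⟨z, hz⟩ := h
      have e : p + m • p = p + ((m + 1) • p + z) := by
        calc p + m • p = (m + 1) • p := (succ_nsmul' p m).symm
          _ = (m + 1 + 1) • p + z := hz
          _ = p + ((m + 1) • p + z) := by rw [succ_nsmul' p (m + 1)]; abel
      obtain ⟨w, x, y, t, h1, h2, h3, h4⟩ := href _ _ _ _ e
      have hcase : algLE p w ∨ (algLE p x ∧ algLE p y) := by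
        rcases hp.2 w x (h1 ▸ algLE.refl p) with h | h
        · exact Or.inl h
        · rcases hp.2 w y (h3 ▸ algLE.refl p) with h' | h'
          · exact Or.inl h'
          · exact Or.inr ⟨h, h'⟩
      have hxp : algLE x p := h1 ▸ algLE_add_left x w
      have hxt : algLE ((m + 1) • p) (x + t) := h4 ▸ algLE_add_right _ z
      rcases hcase with ⟨w', rfl⟩ | ⟨-, hpy⟩
      · have hpx : algLE (p + x) p := ⟨w', by rw [add_right_comm]; exact h1⟩
        refine hxt.trans ?_
        obtain ⟨k, rfl⟩ := Nat.exists_eq_add_of_le' hm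
        have : algLE (x + t) (k • p + (p + x)) := by
          have e' : k • p + (p + x) = x + t + y := by
            rw [← add_assoc, ← succ_nsmul, h2]; abel
          exact e' ▸ algLE_add_right _ y
        refine this.trans ?_
        rw [succ_nsmul]
        exact (algLE.refl _).add hpx
      · exact hxt.trans (h2 ▸ (hxp.trans hpy).add (algLE.refl t))
  simp only [IsFreeElem, not_forall, not_le] at hfree
  obtain ⟨n, m, h, hmn⟩ := hfree
  exact step m ((algLE_nsmul_of_le p hmn).trans h)

theorem exists_idempotent {x : M} (hx : algLE (x + x) x) :
    ∃ e : M, e + e = e ∧ x + e = x ∧ algLE x e ∧ algLE e x := by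
  obtain ⟨z, hz⟩ := hx
  have hxe : x + (x + z) = x := by rw [← add_assoc]; exact hz.symm
  refine ⟨x + z, ?_, hxe, algLE_add_right x z, ⟨x, ?_⟩⟩
  · calc x + z + (x + z) = x + (x + z) + z := by abel
      _ = x + z := by rw [hxe]
  · rw [add_comm, hxe]

end Basic
section FinitelyGenerated

variable {M : Type} [AddCommMonoid M]

theorem exists_finsupp_surjective (M : Type) [AddCommMonoid M] [AddMonoid.FG M] :
    ∃ (S : Finset M) (f : (S →₀ ℕ) →+ M), Function.Surjective f := by
  obtain ⟨S, hS⟩ := AddMonoid.FG.fg_top (M := M)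
  refine ⟨S, Finsupp.liftAddHom fun s => (multiplesHom M) (s : M), ?_⟩
  rw [← AddMonoidHom.mrange_eq_top, ← top_le_iff, ← hS, AddSubmonoid.closure_le]
  intro s hs
  exact ⟨Finsupp.single ⟨s, hs⟩ 1, by simp⟩

theorem countable_of_fg (M : Type) [AddCommMonoid M] [AddMonoid.FG M] : Countable M := by
  obtain ⟨S, f, hf⟩ := exists_finsupp_surjective M
  exact hf.countable

/-- By Dickson's lemma, the algebraic preorder of a finitely generated commutative monoid
satisfies the descending chain condition. -/
theorem wellFounded_classLT [AddMonoid.FG M] : WellFounded (classLT (M := M)) := by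
  obtain ⟨S, f, hf⟩ := exists_finsupp_surjective M
  have hmono : ∀ {a b : S →₀ ℕ}, a ≤ b → algLE (f a) (f b) := fun {a b} hab => by
    obtain ⟨c, rfl⟩ := exists_add_of_le hab
    exact ⟨f c, map_add f a c⟩
  let _ := algPreorder M
  have : WellQuasiOrderedLE M := ⟨fun u => by
    choose g hg using fun n => hf (u n)
    obtain ⟨i, j, hij, h⟩ := wellQuasiOrdered_le (α := S →₀ ℕ) g
    exact ⟨i, j, hij, by rw [← hg i, ← hg j]; exact hmono h⟩⟩
  exact (wellFounded_lt : WellFounded (· < · : M → M → Prop))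

/-- A finitely generated refinement monoid is primely generated. -/
theorem mem_closure_prime [AddMonoid.FG M] (hcon : IsConical M) (href : IsRefinement M) (x : M) :
    x ∈ AddSubmonoid.closure {q : M | IsPrimeElem q} := by
  induction x using (wellFounded_classLT (M := M)).induction with
  | _ x ih =>
    by_cases hx0 : x = 0
    · exact hx0 ▸ zero_mem _
    by_cases hx : IsPrimeElem x
    · exact AddSubmonoid.subset_closure hx
    have hunit : ∀ q : M, x + q ≠ 0 := fun q hq => hx0 (hcon x q hq).1
    simp only [IsPrimeElem, not_and, not_forall, not_or] at hx
    obtain ⟨a, b, ⟨z, hz⟩, ha, hb⟩ := hx hunit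
    obtain ⟨w, x', y, t, h1, h2, h3, -⟩ := href _ _ _ _ hz
    rw [h3]
    refine add_mem (ih w ⟨h3 ▸ algLE_add_right w y, fun h => ha ?_⟩)
      (ih y ⟨h3 ▸ algLE_add_left y w, fun h => hb ?_⟩)
    · exact h.trans (h1 ▸ algLE_add_right w x')
    · exact h.trans (h2 ▸ algLE_add_right y t)

/-- Every prime is equivalent to a member of any generating set. -/
theorem exists_generator_equiv {S : Finset M} (hS : AddSubmonoid.closure (S : Set M) = ⊤)
    {q : M} (hq : IsPrimeElem q) : ∃ g ∈ S, algLE q g ∧ algLE g q := by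
  have key : ∀ x : M, algLE q x → ∃ g ∈ S, algLE q g ∧ algLE g x := by
    intro x
    have hx : x ∈ AddSubmonoid.closure (S : Set M) := hS ▸ AddSubmonoid.mem_top x
    induction hx using AddSubmonoid.closure_induction with
    | mem x hx => exact fun h => ⟨x, hx, h, algLE.refl x⟩
    | zero => exact fun h => absurd h hq.not_le_zero
    | add x y _ _ ihx ihy =>
      intro h
      rcases hq.2 x y h with h | h
      · obtain ⟨g, hg, h1, h2⟩ := ihx h
        exact ⟨g, hg, h1, h2.trans (algLE_add_right x y)⟩
      · obtain ⟨g, hg, h1, h2⟩ := ihy h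
        exact ⟨g, hg, h1, h2.trans (algLE_add_left y x)⟩
  exact key q (algLE.refl q)

/-- An order ideal of a finitely generated monoid has an order unit. -/
theorem exists_orderUnit [AddMonoid.FG M] {I : Set M} (hI : IsOrderIdeal I) :
    ∃ s ∈ I, ∀ z ∈ I, ∃ k : ℕ, algLE z (k • s) := by
  classical
  obtain ⟨S, hS⟩ := AddMonoid.FG.fg_top (M := M)
  have hsum : ∀ T : Finset M, (∀ g ∈ T, g ∈ I) → ∑ g ∈ T, g ∈ I := by
    intro T
    induction T using Finset.induction_on with
    | empty => simpa using hI.1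
    | insert a T ha ih =>
      intro h
      rw [Finset.sum_insert ha]
      exact hI.2.1 _ _ (h a (Finset.mem_insert_self a T))
        (ih fun g hg => h g (Finset.mem_insert_of_mem hg))
  refine ⟨∑ g ∈ S.filter (· ∈ I), g, hsum _ fun g hg => (Finset.mem_filter.1 hg).2, ?_⟩
  intro z
  have hz : z ∈ AddSubmonoid.closure (S : Set M) := hS ▸ AddSubmonoid.mem_top z
  induction hz using AddSubmonoid.closure_induction with
  | mem x hx =>
    intro hxI
    refine ⟨1, ?_⟩
    rw [one_nsmul, ← Finset.add_sum_erase _ _ (Finset.mem_filter.2 ⟨hx, hxI⟩)]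
    exact algLE_add_right x _
  | zero => exact fun _ => ⟨0, by simpa using algLE.refl (0 : M)⟩
  | add x y _ _ ihx ihy =>
    intro h
    exact (isOrderIdeal_le_nsmul _).2.1 _ _ (ihx (hI.2.2 _ _ (algLE_add_right x y) h))
      (ihy (hI.2.2 _ _ (algLE_add_left y x) h))

/-- An order ideal containing every prime strictly below `p` contains every element
strictly below `p`. -/
theorem mem_ideal_of_classLT [AddMonoid.FG M] (hcon : IsConical M) (href : IsRefinement M)
    {I : Set M} (hI : IsOrderIdeal I) {p : M}
    (hp : ∀ q : M, IsPrimeElem q → classLT q p → q ∈ I) {z : M} (hz : classLT z p) : z ∈ I := by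
  have hz' := mem_closure_prime hcon href z
  induction hz' using AddSubmonoid.closure_induction with
  | mem x hx => exact hp x hx hz
  | zero => exact hI.1
  | add x y _ _ ihx ihy =>
    have hx := algLE_add_right x y
    have hy := algLE_add_left y x
    exact hI.2.1 _ _ (ihx ⟨hx.trans hz.1, fun h => hz.2 (h.trans hx)⟩)
      (ihy ⟨hy.trans hz.1, fun h => hz.2 (h.trans hy)⟩)

theorem IsFreeElem.classLT_of_absorbed {p z : M} (hp : IsFreeElem p) (hz : algLE (p + z) p) :
    classLT z p :=
  ⟨absorbed_le hz, fun h => hp.not_two_le (((algLE.refl p).add h).trans hz)⟩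

end FinitelyGenerated
section LowerCover

variable {M : Type} [AddCommMonoid M]

theorem classLT.trans_le {x y z : M} (hxy : classLT x y) (hyz : algLE y z) : classLT x z :=
  ⟨hxy.1.trans hyz, fun h => hxy.2 (hyz.trans h)⟩

theorem classLT.le_trans {x y z : M} (hyz : classLT y z) (hxy : algLE x y) : classLT x z :=
  ⟨hxy.trans hyz.1, fun h => hyz.2 (h.trans hxy)⟩

theorem InLowerCover.congr {p q q' : M} (h : InLowerCover p q) (h1 : algLE q q')
    (h2 : algLE q' q) : InLowerCover p q' :=
  ⟨h.1.congr h1 h2, h.2.1.le_trans h2,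
    fun ⟨t, ht, hqt, htp⟩ => h.2.2 ⟨t, ht, hqt.le_trans h1, htp⟩⟩

theorem exists_inLowerCover_ge [AddMonoid.FG M] {p q : M} (hq : IsPrimeElem q)
    (hqp : classLT q p) : ∃ t : M, InLowerCover p t ∧ algLE q t := by
  classical
  obtain ⟨S, hS⟩ := AddMonoid.FG.fg_top (M := M)
  obtain ⟨g, hgS, hqg, hgq⟩ := exists_generator_equiv hS hq
  let _ := algPreorder M
  obtain ⟨t, hgt, ht⟩ := (S.filter fun g => IsPrimeElem g ∧ classLT g p).exists_le_maximal
    (a := g) (Finset.mem_filter.2 ⟨hgS, hq.congr hqg hgq, hqp.le_trans hgq⟩)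
  obtain ⟨htS, htprime, htp⟩ := Finset.mem_filter.1 ht.prop
  refine ⟨t, ⟨htprime, htp, ?_⟩, hqg.trans hgt⟩
  rintro ⟨r, hr, htr, hrp⟩
  obtain ⟨g', hgS', hrg, hgr⟩ := exists_generator_equiv hS hr
  have := ht.le_of_ge (Finset.mem_filter.2 ⟨hgS', hr.congr hrg hgr, hrp.le_trans hgr⟩)
    (htr.1.trans hrg)
  exact htr.2 (hrg.trans this)

theorem exists_isLowerCoverReps [AddMonoid.FG M] (p : M) :
    ∃ Q : Finset M, IsLowerCoverReps p Q := by
  classical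
  obtain ⟨S, hS⟩ := AddMonoid.FG.fg_top (M := M)
  let _ := algPreorder M
  let rep : M → M := fun g => (Quotient.mk (AntisymmRel.setoid M (· ≤ ·)) g).out
  have hrep : ∀ g, algLE (rep g) g ∧ algLE g (rep g) := fun g =>
    Quotient.exact (s := AntisymmRel.setoid M (· ≤ ·)) (Quotient.out_eq _)
  refine ⟨(S.filter (InLowerCover p)).image rep, ?_, ?_, ?_⟩
  · intro q hq
    obtain ⟨g, hg, rfl⟩ := Finset.mem_image.1 hq
    exact (Finset.mem_filter.1 hg).2.congr (hrep g).2 (hrep g).1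
  · intro q hq q' hq' h h'
    obtain ⟨g, -, rfl⟩ := Finset.mem_image.1 hq
    obtain ⟨g', -, rfl⟩ := Finset.mem_image.1 hq'
    have : AntisymmRel (· ≤ ·) g g' :=
      ⟨((hrep g).2.trans h).trans (hrep g').1, ((hrep g').2.trans h').trans (hrep g).1⟩
    exact congrArg Quotient.out (Quotient.sound (s := AntisymmRel.setoid M (· ≤ ·)) this)
  · intro t ht
    obtain ⟨g, hgS, htg, hgt⟩ := exists_generator_equiv hS ht.1
    exact ⟨rep g, Finset.mem_image_of_mem rep (Finset.mem_filter.2 ⟨hgS, ht.congr htg hgt⟩),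
      (hrep g).1.trans hgt, htg.trans (hrep g).2⟩

theorem IsLowerCoverReps.sum_absorbed {p : M} (hp : IsPrimeElem p) {Q : Finset M}
    (hQ : IsLowerCoverReps p Q) : algLE (p + ∑ q ∈ Q, q) p := by
  have : ∀ T ⊆ Q, algLE (p + ∑ q ∈ T, q) p := by
    classical
    intro T
    induction T using Finset.induction_on with
    | empty => simpa using algLE.refl p
    | insert a T ha ih =>
      intro h
      rw [Finset.sum_insert ha]
      exact absorbed_add (hp.add_le_of_classLT (hQ.1 a (h (Finset.mem_insert_self a T))).2.1)
        (ih ((Finset.subset_insert a T).trans h))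
  exact this Q subset_rfl

theorem IsLowerCoverReps.le_nsmul_sum [AddMonoid.FG M] (hcon : IsConical M)
    (href : IsRefinement M) {p : M} {Q : Finset M}
    (hQ : IsLowerCoverReps p Q) {z : M} (hz : classLT z p) :
    ∃ k : ℕ, algLE z (k • ∑ q ∈ Q, q) := by
  classical
  refine mem_ideal_of_classLT hcon href (isOrderIdeal_le_nsmul _) (fun q hq hqp => ?_) hz
  obtain ⟨t, ht, hqt⟩ := exists_inLowerCover_ge hq hqp
  obtain ⟨r, hr, -, htr⟩ := hQ.2.2 t ht
  refine ⟨1, (hqt.trans htr).trans ?_⟩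
  rw [one_nsmul, ← Finset.add_sum_erase _ _ hr]
  exact algLE_add_right r _

end LowerCover

section AbsorptionCyclic

variable {M : Type} [AddCommMonoid M]

/-- There is an element `x` absorbed by `p` which is an order unit of the ideal of elements
absorbed by `p`, and which generates the kernel of `u ↦ p + u` up to group completion. -/
def AbsorptionCyclic (p : M) : Prop :=
  ∃ x : M, p + x = p ∧ (∀ z : M, algLE (p + z) p → ∃ k : ℕ, algLE z (k • x)) ∧
    ∀ u v : M, algLE (p + u) p → p + u = p + v → ∃ n m : ℕ, u + n • x = v + m • x

theorem AbsorptionCyclic.congr {p q : M} (hp : AbsorptionCyclic p) (hpq : algLE p q)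
    (hqp : algLE q p) : AbsorptionCyclic q := by
  obtain ⟨x, hx, hunit, hker⟩ := hp
  have hle : ∀ {z : M}, algLE (q + z) q → algLE (p + z) p := fun h =>
    ((hpq.add (algLE.refl _)).trans h).trans hqp
  have heq : ∀ {u v : M}, q + u = q + v → p + u = p + v := by
    obtain ⟨b, hb⟩ := hqp
    intro u v h
    rw [hb, add_right_comm, h, add_right_comm]
  obtain ⟨a, ha⟩ := hpq
  exact ⟨x, by rw [ha, add_right_comm, hx], fun z hz => hunit z (hle hz),
    fun u v hu huv => hker u v (hle hu) (heq huv)⟩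

/-- The group `G'_p`, as a type. -/
abbrev GpType (p : M) : Type := ↥(GpSet p)

theorem GpSet_mem {p α : M} (h : algLE (p + α) p) : p + α ∈ GpSet p := ⟨α, rfl, h⟩

theorem add_add_congr {p α α' β β' : M} (h : p + α = p + α') (h' : p + β = p + β') :
    p + (α + β) = p + (α' + β') := by
  calc p + (α + β) = p + α + β := by abel
    _ = p + β + α' := by rw [h]; abel
    _ = p + (α' + β') := by rw [h']; abel

theorem exists_addCommGroup_GpType (p : M) :
    ∃ inst : AddCommGroup (GpType p), @GpStructure M _ p (GpType p) inst Subtype.val := by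
  classical
  let a : GpType p → M := fun u => u.2.choose
  have ha : ∀ u : GpType p, (u : M) = p + a u := fun u => u.2.choose_spec.1
  have hle : ∀ u : GpType p, algLE (p + a u) p := fun u => ha u ▸ u.2.choose_spec.2
  have hneg : ∀ u : GpType p, ∃ z : M, p = p + a u + z := fun u => hle u
  choose b hb using hneg
  let addI : Add (GpType p) :=
    ⟨fun u v => ⟨p + (a u + a v), GpSet_mem (absorbed_add (hle u) (hle v))⟩⟩
  let zeroI : Zero (GpType p) := ⟨⟨p, 0, (add_zero p).symm, algLE.refl p⟩⟩
  let negI : Neg (GpType p) := ⟨fun u => ⟨p + b u, GpSet_mem ⟨a u, by rw [add_right_comm, ← hb]⟩⟩⟩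
  have hadd : ∀ (u v : GpType p) (α β : M), (u : M) = p + α → (v : M) = p + β →
      ((u + v : GpType p) : M) = p + (α + β) := fun u v α β hu hv =>
    add_add_congr ((ha u).symm.trans hu) ((ha v).symm.trans hv)
  have hzero : ((0 : GpType p) : M) = p + 0 := (add_zero p).symm
  let grp : AddGroup (GpType p) := AddGroup.ofLeftAxioms
    (fun u v w => Subtype.ext <| by
      rw [hadd _ w _ _ (hadd u v _ _ (ha u) (ha v)) (ha w),
        hadd u _ _ _ (ha u) (hadd v w _ _ (ha v) (ha w)), add_assoc])
    (fun u => Subtype.ext <| by rw [hadd 0 u _ _ hzero (ha u), zero_add, ← ha])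
    (fun u => Subtype.ext <| by
      have hnu : ((-u : GpType p) : M) = p + b u := rfl
      rw [hadd (-u) u _ _ hnu (ha u), hzero, add_zero, add_comm (b u), ← add_assoc, ← hb])
  let inst : AddCommGroup (GpType p) :=
    { grp with
      add_comm := fun u v => Subtype.ext <| by
        rw [hadd u v _ _ (ha u) (ha v), hadd v u _ _ (ha v) (ha u), add_comm (a u)] }
  exact ⟨inst,
    { inj := Subtype.val_injective
      range_eq := Subtype.range_coe
      map_zero := rfl
      map_add := hadd }⟩

end AbsorptionCyclic
section AlmostIso

variable {M : Type} [AddCommMonoid M]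

theorem IsGrothendieck.exists_sub {S : Type} [AddCommSemigroup S] [Nonempty S] {Γ : Type}
    [AddCommGroup Γ] {ι : AddHom S Γ} (h : IsGrothendieck S Γ ι) (γ : Γ) :
    ∃ a b : S, γ = ι a - ι b := by
  let H := AddSubgroup.closure (Set.range ι)
  obtain ⟨g, -, hg⟩ := h (Γ ⧸ H) 0
  have h1 : QuotientAddGroup.mk' H = 0 := by
    rw [hg (QuotientAddGroup.mk' H) fun x => ?_, hg 0 fun _ => rfl]
    exact (QuotientAddGroup.eq_zero_iff _).2 (AddSubgroup.subset_closure ⟨x, rfl⟩)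
  have hγ : γ ∈ H := (QuotientAddGroup.eq_zero_iff γ).1 (DFunLike.congr_fun h1 γ)
  induction hγ using AddSubgroup.closure_induction with
  | mem x hx =>
    obtain ⟨a, rfl⟩ := hx
    exact ⟨a + a, a, by rw [map_add]; abel⟩
  | zero =>
    obtain ⟨a⟩ := ‹Nonempty S›
    exact ⟨a, a, (sub_self _).symm⟩
  | add x y _ _ hx hy =>
    obtain ⟨a, b, rfl⟩ := hx
    obtain ⟨c, d, rfl⟩ := hy
    exact ⟨a + c, b + d, by rw [map_add, map_add]; abel⟩
  | neg x _ hx =>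
    obtain ⟨a, b, rfl⟩ := hx
    exact ⟨b, a, neg_sub _ _⟩

theorem self_mem_archComp (s : M) : s ∈ archComp s :=
  ⟨1, 1, one_pos, one_pos, by simpa using algLE.refl s, by simpa using algLE.refl s⟩

theorem add_mem_archComp {s a z : M} (ha : a ∈ archComp s) (hz : ∃ k : ℕ, algLE z (k • s)) :
    a + z ∈ archComp s := by
  obtain ⟨n, m, hn, hm, h1, h2⟩ := ha
  obtain ⟨k, hk⟩ := hz
  exact ⟨n + k, m, by omega, hm, by rw [add_nsmul]; exact h1.add hk,
    h2.trans ((algLE_add_right a z).nsmul m)⟩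

theorem absorbed_of_mem_archComp {p s a : M} (hs : algLE (p + s) p) (ha : a ∈ archComp s) :
    algLE (p + a) p := by
  obtain ⟨n, m, hn, hm, h1, h2⟩ := ha
  exact absorbed_mono h1 (absorbed_nsmul hs n)

theorem map_add_nsmul {s : M} {Γ : Type} [AddCommGroup Γ] (ι : AddHom (archComp s) Γ)
    (a x : archComp s) (n : ℕ) (h : (a : M) + n • (x : M) ∈ archComp s) :
    ι ⟨(a : M) + n • (x : M), h⟩ = ι a + n • ι x := by
  induction n with
  | zero => simp
  | succ n ih =>
    have h' : (a : M) + n • (x : M) ∈ archComp s := by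
      obtain ⟨k, l, hk, hl, h1, -⟩ := x.2
      exact add_mem_archComp a.2 ⟨n * k, by rw [mul_comm, mul_nsmul]; exact h1.nsmul n⟩
    rw [succ_nsmul (ι x), ← add_assoc, ← ih h', ← map_add]
    congr 1
    exact Subtype.ext ((congrArg (fun y => (a : M) + y) (succ_nsmul (x : M) n)).trans
      (add_assoc _ _ _).symm)

variable [AddMonoid.FG M] (hcon : IsConical M) (href : IsRefinement M)
include hcon href

theorem AbsorptionCyclic.almostIsoCondition {p : M} (hp : IsPrimeElem p) (hfree : IsFreeElem p)
    {Q : Finset M} (hQ : IsLowerCoverReps p Q) (h : AbsorptionCyclic p) :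
    AlmostIsoCondition M p Q := by
  intro Γ _ ι hι G' _ j hj φ hφ ψ hψ
  obtain ⟨x, hpx, hunit, hker⟩ := h
  have hs := hQ.sum_absorbed hp
  have hbound : ∀ z : M, algLE (p + z) p → ∃ k : ℕ, algLE z (k • ∑ q ∈ Q, q) := fun z hz =>
    hQ.le_nsmul_sum hcon href (hfree.classLT_of_absorbed hz)
  generalize (∑ q ∈ Q, q) = s at *
  have hself := self_mem_archComp s
  have hxabs : algLE (p + x) p := by rw [hpx]; exact algLE.refl p
  have hx : x ∈ archComp s := by
    obtain ⟨n, hn⟩ := hbound x hxabs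
    obtain ⟨m, hm⟩ := hunit s hs
    exact ⟨n + 1, m + 1, n.succ_pos, m.succ_pos, hn.trans (algLE_nsmul_of_le s n.le_succ),
      hm.trans (algLE_nsmul_of_le x m.le_succ)⟩
  have hιx : ψ (ι ⟨x, hx⟩) = 0 := by
    rw [hψ]
    exact hj.inj (by rw [hφ, hj.map_zero, hpx])
  refine ⟨fun g => ?_, ⟨x, hx⟩, le_antisymm (fun γ hγ => ?_) ?_⟩
  · obtain ⟨α, hα, hle⟩ : j g ∈ GpSet p := hj.range_eq ▸ Set.mem_range_self g
    rw [hα] at hle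
    obtain ⟨γ, hγ⟩ := hs
    have hγ' : algLE (p + γ) p := ⟨s, by rw [add_right_comm, ← hγ]⟩
    refine ⟨ι ⟨s + (γ + α), add_mem_archComp hself (hbound _ (absorbed_add hγ' hle))⟩, ?_⟩
    rw [hψ]
    refine hj.inj ?_
    rw [hφ, hα]
    change p + (s + (γ + α)) = p + α
    rw [← add_assoc, ← add_assoc, ← hγ]
  · have : Nonempty (archComp s) := ⟨⟨s, hself⟩⟩
    obtain ⟨a, b, rfl⟩ := hι.exists_sub γ
    have hab : φ a = φ b := by
      have : ψ (ι a - ι b) = 0 := hγ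
      rwa [map_sub, hψ, hψ, sub_eq_zero] at this
    have hpab : p + (a : M) = p + b := by rw [← hφ, ← hφ, hab]
    obtain ⟨n, m, hnm⟩ := hker a b (absorbed_of_mem_archComp hs a.2) hpab
    have hmem : ∀ (c : archComp s) (n : ℕ), (c : M) + n • x ∈ archComp s := fun c n =>
      add_mem_archComp c.2 (hbound _ (absorbed_nsmul hxabs n))
    have e := map_add_nsmul ι a ⟨x, hx⟩ n (hmem a n)
    have e' := map_add_nsmul ι b ⟨x, hx⟩ m (hmem b m)
    have e'' : (⟨(a : M) + n • x, hmem a n⟩ : archComp s) = ⟨(b : M) + m • x, hmem b m⟩ :=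
      Subtype.ext hnm
    rw [e'', e'] at e
    refine AddSubgroup.mem_zmultiples_iff.2 ⟨(m : ℤ) - n, ?_⟩
    rw [sub_zsmul, natCast_zsmul, natCast_zsmul,
      ← add_sub_add_right_eq_sub (ι a) (ι b) (n • ι ⟨x, hx⟩), ← e]
    abel
  · rw [AddSubgroup.zmultiples_le]
    exact hιx

theorem absorptionCyclic_of_almostIsoCondition {p : M} (hp : IsPrimeElem p)
    (hfree : IsFreeElem p) {Q : Finset M} (hQ : IsLowerCoverReps p Q)
    (h : AlmostIsoCondition M p Q) : AbsorptionCyclic p := by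
  unfold AlmostIsoCondition at h
  have hs := hQ.sum_absorbed hp
  have hbound : ∀ z : M, algLE (p + z) p → ∃ k : ℕ, algLE z (k • ∑ q ∈ Q, q) := fun z hz =>
    hQ.le_nsmul_sum hcon href (hfree.classLT_of_absorbed hz)
  generalize (∑ q ∈ Q, q) = s at *
  have hself := self_mem_archComp s
  let I : AddSubmonoid M :=
    { carrier := {z | algLE (p + z) p}
      zero_mem' := (isOrderIdeal_absorbed p).1
      add_mem' := fun hu hv => absorbed_add hu hv }
  have habs : ∀ a : archComp s, (a : M) ∈ I := fun a => absorbed_of_mem_archComp hs a.2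
  let ι₀ : I →+ Algebra.GrothendieckAddGroup I := Algebra.GrothendieckAddGroup.of
  have hι₀ : ∀ u v : I, ι₀ u = ι₀ v → ∃ c : I, c + u = c + v := fun u v huv => by
    obtain ⟨c, hc⟩ := (AddLocalization.addMonoidOf (⊤ : AddSubmonoid I)).eq_iff_exists.1 huv
    exact ⟨c, hc⟩
  let ι : AddHom (archComp s) (Algebra.GrothendieckAddGroup I) :=
    { toFun := fun a => ι₀ ⟨a, habs a⟩
      map_add' := fun a b => by rw [← map_add]; rfl }
  let sS : archComp s := ⟨s, hself⟩
  let shift : I → archComp s := fun z => ⟨s + z, add_mem_archComp hself (hbound z z.2)⟩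
  have hι_shift : ∀ z : I, ι (shift z) = ι sS + ι₀ z := fun z => by
    change ι₀ _ = ι₀ _ + ι₀ z
    rw [← map_add]; rfl
  have hG : IsGrothendieck (archComp s) (Algebra.GrothendieckAddGroup I) ι := by
    intro A _ f
    let f₀ : I →+ A :=
      { toFun := fun z => f (shift z) - f sS
        map_zero' := by
          rw [sub_eq_zero]
          exact congrArg f (Subtype.ext (add_zero s))
        map_add' := fun y z => by
          have : f (shift (y + z)) + f sS = f (shift y) + f (shift z) := by
            rw [← map_add, ← map_add]
            refine congrArg f (Subtype.ext ?_)
            change s + ((y : M) + z) + s = s + y + (s + z)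
            abel
          rw [eq_sub_of_add_eq this]
          abel }
    refine ⟨Algebra.GrothendieckAddGroup.lift f₀, fun a => ?_, fun g hg => ?_⟩
    · have h1 : Algebra.GrothendieckAddGroup.lift f₀ (ι₀ ⟨a, habs a⟩) = f₀ ⟨a, habs a⟩ :=
        DFunLike.congr_fun (Algebra.GrothendieckAddGroup.lift.symm_apply_apply f₀) _
      refine h1.trans ?_
      change f (shift ⟨a, habs a⟩) - f sS = f a
      rw [sub_eq_iff_eq_add, ← map_add]
      exact congrArg f (Subtype.ext (add_comm s a))
    · refine (Equiv.symm_apply_eq _).1 ?_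
      ext z
      change g (ι₀ z) = f (shift z) - f sS
      rw [← hg, ← hg, hι_shift, map_add, add_sub_cancel_left]
  obtain ⟨inst, hj⟩ := exists_addCommGroup_GpType p
  let φ : AddHom (archComp s) (GpType p) :=
    { toFun := fun a => ⟨p + a, GpSet_mem (habs a)⟩
      map_add' := fun a b => hj.inj (hj.map_add _ _ _ _ rfl rfl).symm }
  obtain ⟨ψ, hψ, -⟩ := hG (GpType p) φ
  obtain ⟨-, x, hx⟩ := h _ ι hG (GpType p) Subtype.val hj φ (fun a => rfl) ψ hψ
  have hpx : p + (x : M) = p := by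
    have : ι x ∈ ψ.ker := hx ▸ AddSubgroup.mem_zmultiples _
    have : φ x = 0 := (hψ x).symm.trans this
    exact (congrArg Subtype.val this).trans hj.map_zero
  have hunit : ∀ z : M, algLE (p + z) p → ∃ k : ℕ, algLE z (k • (x : M)) := fun z hz => by
    obtain ⟨k, hk⟩ := hbound z hz
    obtain ⟨-, m, -, -, -, hm⟩ := x.2
    exact ⟨m * k, by rw [mul_nsmul]; exact hk.trans (hm.nsmul k)⟩
  refine ⟨x, hpx, hunit, fun u v hu huv => ?_⟩
  have hv : algLE (p + v) p := huv ▸ hu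
  have hmem : ι₀ ⟨u, hu⟩ - ι₀ ⟨v, hv⟩ ∈ ψ.ker := by
    have e : ι₀ ⟨u, hu⟩ - ι₀ ⟨v, hv⟩ = ι (shift ⟨u, hu⟩) - ι (shift ⟨v, hv⟩) := by
      rw [hι_shift, hι_shift, add_sub_add_left_eq_sub]
    rw [e, AddMonoidHom.mem_ker, map_sub, hψ, hψ, sub_eq_zero]
    refine hj.inj ?_
    change p + (s + u) = p + (s + v)
    rw [add_left_comm, huv, add_left_comm]
  rw [hx] at hmem
  obtain ⟨k, hk⟩ := AddSubgroup.mem_zmultiples_iff.1 hmem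
  let xI : I := ⟨x, habs x⟩
  have e : ι₀ (⟨u, hu⟩ + (-k).toNat • xI) = ι₀ (⟨v, hv⟩ + k.toNat • xI) := by
    have hk' : (k.toNat : ℤ) • ι₀ xI - ((-k).toNat : ℤ) • ι₀ xI = ι₀ ⟨u, hu⟩ - ι₀ ⟨v, hv⟩ := by
      rw [sub_eq_add_neg, ← sub_zsmul, Int.toNat_sub_toNat_neg]
      exact hk
    rw [natCast_zsmul, natCast_zsmul, sub_eq_sub_iff_add_eq_add] at hk'
    rw [map_add, map_add, map_nsmul, map_nsmul, ← hk', add_comm]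
  obtain ⟨c, hc⟩ := hι₀ _ _ e
  have hc' : (c : M) + (u + (-k).toNat • (x : M)) = c + (v + k.toNat • (x : M)) :=
    congrArg Subtype.val hc
  obtain ⟨l, d, hl⟩ := hunit c c.2
  refine ⟨(-k).toNat + l, k.toNat + l, ?_⟩
  calc u + ((-k).toNat + l) • (x : M) = c + (u + (-k).toNat • (x : M)) + d := by
        rw [add_nsmul, hl]; abel
    _ = v + (k.toNat + l) • (x : M) := by rw [hc', add_nsmul, hl]; abel

end AlmostIso
section Presentation

/-- The relations `v = w v`, where `v` runs over `V`, on the free commutative monoid on `V`. -/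
def vertexRel {V : Type} (w : V → V →₀ ℕ) (x y : V →₀ ℕ) : Prop :=
  ∃ v : V, x = Finsupp.single v 1 ∧ y = w v

theorem IsGraphMonoid.exists_presentation {M : Type} [AddCommMonoid M] (h : IsGraphMonoid M) :
    ∃ (V : Type) (w : V → V →₀ ℕ) (π : (V →₀ ℕ) →+ M), Function.Surjective π ∧
      ∀ α β, π α = π β ↔ addConGen (vertexRel w) α β := by
  classical
  obtain ⟨G, ⟨f⟩⟩ := h
  let w : G.V → G.V →₀ ℕ := fun v =>
    if ∃ e : G.E, G.s e = v then ∑ e ∈ (G.rowFinite v).toFinset, Finsupp.single (G.r e) 1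
    else Finsupp.single v 1
  have hw : addConGen (graphRel G) = addConGen (vertexRel w) := by
    refine le_antisymm (AddCon.addConGen_le.2 ?_) (AddCon.addConGen_le.2 ?_)
    · rintro x y ⟨v, hv, rfl, rfl⟩
      exact AddConGen.Rel.of _ _ ⟨v, rfl, (if_pos hv).symm⟩
    · rintro x y ⟨v, rfl, rfl⟩
      by_cases hv : ∃ e : G.E, G.s e = v
      · exact AddConGen.Rel.of _ _ ⟨v, hv, rfl, if_pos hv⟩
      · have : w v = Finsupp.single v 1 := if_neg hv
        rw [this]
        exact AddConGen.Rel.refl _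
  refine ⟨G.V, w, f.symm.toAddMonoidHom.comp (addConGen (graphRel G)).mk', ?_, fun α β => ?_⟩
  · exact f.symm.surjective.comp (AddCon.mk'_surjective)
  · rw [← hw, ← AddCon.eq]
    exact f.symm.injective.eq_iff

theorem exists_list_sum_single {V : Type} (α : V →₀ ℕ) :
    ∃ L : List V, (L.map fun v => Finsupp.single v 1).sum = α := by
  induction α using Finsupp.induction_linear with
  | zero => exact ⟨[], rfl⟩
  | add f g hf hg =>
    obtain ⟨L, rfl⟩ := hf
    obtain ⟨L', rfl⟩ := hg
    exact ⟨L ++ L', by simp⟩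
  | single v n => exact ⟨List.replicate n v, by simp⟩

theorem isGraphMonoid_of_presentation {M : Type} [AddCommMonoid M] {V : Type} [Countable V]
    (w : V → V →₀ ℕ) (hw : ∀ v, w v ≠ 0) (π : (V →₀ ℕ) →+ M) (hsurj : Function.Surjective π)
    (hπ : ∀ α β, π α = π β ↔ addConGen (vertexRel w) α β) : IsGraphMonoid M := by
  classical
  choose L hL using fun v => exists_list_sum_single (w v)
  have hrow : ∀ v, {e : Σ v, Fin (L v).length | e.1 = v} = Set.range (Sigma.mk v) := fun v => by
    ext ⟨u, i⟩
    constructor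
    · rintro rfl
      exact ⟨i, rfl⟩
    · rintro ⟨j, hj⟩
      exact (congrArg Sigma.fst hj).symm
  let G : RowFiniteGraph :=
    { V := V
      E := Σ v, Fin (L v).length
      countableV := inferInstance
      countableE := inferInstance
      s := Sigma.fst
      r := fun e => (L e.1).get e.2
      rowFinite := fun v => by rw [hrow]; exact Set.finite_range _ }
  have hsum : ∀ v : V, ∑ e ∈ (G.rowFinite v).toFinset, Finsupp.single (G.r e) 1 = w v := by
    intro v
    have : (G.rowFinite v).toFinset =
        Finset.univ.image (Sigma.mk (β := fun v => Fin (L v).length) v) := by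
      ext e
      rw [Set.Finite.mem_toFinset, Finset.mem_image]
      change e ∈ {e : Σ v, Fin (L v).length | e.1 = v} ↔ _
      rw [hrow]
      simp only [Set.mem_range, Finset.mem_univ, true_and]
    have h' : ∑ i : Fin (L v).length, Finsupp.single ((L v).get i) 1 = w v := by
      rw [← List.sum_ofFn]
      conv_rhs => rw [← hL v, ← List.ofFn_get (L v), List.map_ofFn]
      simp [Function.comp_def]
    rw [this, Finset.sum_image (sigma_mk_injective.injOn)]
    exact h'
  have hrel : graphRel G = vertexRel w := by
    ext x y
    constructor
    · rintro ⟨v, -, rfl, rfl⟩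
      exact ⟨v, rfl, hsum v⟩
    · rintro ⟨v, rfl, rfl⟩
      refine ⟨v, ?_, rfl, (hsum v).symm⟩
      by_contra hv
      apply hw v
      rw [← hsum v, Finset.sum_eq_zero]
      intro e he
      have he' : G.s e = v := (Set.Finite.mem_toFinset (G.rowFinite v)).1 he
      exact absurd ⟨e, he'⟩ hv
  have hker : addConGen (graphRel G) = AddCon.ker π := by
    rw [hrel]
    exact AddCon.ext fun α β => (hπ α β).symm
  have hM : Nonempty (M ≃+ (addConGen (graphRel G)).Quotient) := by
    rw [hker]
    exact ⟨(AddCon.quotientKerEquivOfSurjective π hsurj).symm⟩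
  exact ⟨G, hM⟩

end Presentation

section Confluence

variable {V : Type} (w : V → V →₀ ℕ)

/-- Rewrite one occurrence of a vertex `v` as `w v`. -/
def vertexStep (α β : V →₀ ℕ) : Prop :=
  ∃ v ρ, α = Finsupp.single v 1 + ρ ∧ β = w v + ρ

theorem single_add_eq_single_add {v v' : V} {ρ ρ' : V →₀ ℕ}
    (h : Finsupp.single v 1 + ρ = Finsupp.single v' 1 + ρ') :
    (v = v' ∧ ρ = ρ') ∨
      ∃ σ, ρ = Finsupp.single v' 1 + σ ∧ ρ' = Finsupp.single v 1 + σ := by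
  classical
  by_cases hv : v = v'
  · subst hv
    exact Or.inl ⟨rfl, add_left_cancel h⟩
  · right
    have hle : Finsupp.single v' 1 ≤ ρ := by
      rw [Finsupp.single_le_iff]
      have := DFunLike.congr_fun h v'
      rw [Finsupp.add_apply, Finsupp.add_apply, Finsupp.single_eq_same,
        Finsupp.single_eq_of_ne (Ne.symm hv)] at this
      omega
    obtain ⟨σ, rfl⟩ := exists_add_of_le hle
    refine ⟨σ, rfl, add_left_cancel (a := Finsupp.single v' 1) ?_⟩
    rw [← h, add_left_comm]

variable {w}

theorem vertexStep.add_right {α β : V →₀ ℕ} (h : vertexStep w α β) (γ : V →₀ ℕ) :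
    vertexStep w (α + γ) (β + γ) := by
  obtain ⟨v, ρ, rfl, rfl⟩ := h
  exact ⟨v, ρ + γ, add_assoc _ _ _, add_assoc _ _ _⟩

theorem reflTransGen_vertexStep_add {α β γ δ : V →₀ ℕ}
    (h : Relation.ReflTransGen (vertexStep w) α β)
    (h' : Relation.ReflTransGen (vertexStep w) γ δ) :
    Relation.ReflTransGen (vertexStep w) (α + γ) (β + δ) := by
  have h1 := h.lift (· + γ) fun _ _ hab => hab.add_right γ
  have h2 := h'.lift (β + ·) fun a b hab => by
    change vertexStep w (β + a) (β + b)
    rw [add_comm β a, add_comm β b]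
    exact hab.add_right β
  exact h1.trans h2

theorem vertexStep_confluent (α β γ : V →₀ ℕ) (hβ : vertexStep w α β) (hγ : vertexStep w α γ) :
    ∃ δ, Relation.ReflGen (vertexStep w) β δ ∧ Relation.ReflTransGen (vertexStep w) γ δ := by
  obtain ⟨v, ρ, rfl, rfl⟩ := hβ
  obtain ⟨v', ρ', h, rfl⟩ := hγ
  rcases single_add_eq_single_add h with ⟨rfl, rfl⟩ | ⟨σ, rfl, rfl⟩
  · exact ⟨_, .refl, .refl⟩
  · exact ⟨w v' + (w v + σ), .single ⟨v', w v + σ, add_left_comm _ _ _, rfl⟩,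
      .single ⟨v, w v' + σ, add_left_comm _ _ _, add_left_comm _ _ _⟩⟩

theorem exists_common_reduct {α β : V →₀ ℕ} (h : addConGen (vertexRel w) α β) :
    ∃ γ, Relation.ReflTransGen (vertexStep w) α γ ∧ Relation.ReflTransGen (vertexStep w) β γ := by
  let c : AddCon (V →₀ ℕ) :=
    { r := Relation.Join (Relation.ReflTransGen (vertexStep w))
      iseqv := Relation.equivalence_join_reflTransGen vertexStep_confluent
      add' := by
        rintro a b a' b' ⟨d, h1, h2⟩ ⟨d', h1', h2'⟩
        exact ⟨d + d', reflTransGen_vertexStep_add h1 h1', reflTransGen_vertexStep_add h2 h2'⟩ }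
  have hc : addConGen (vertexRel w) ≤ c := by
    refine AddCon.addConGen_le.2 ?_
    rintro x y ⟨v, rfl, rfl⟩
    exact ⟨w v, .single ⟨v, 0, (add_zero _).symm, (add_zero _).symm⟩, .refl⟩
  exact hc h

end Confluence

section FreeVertices

variable {M : Type} [AddCommMonoid M]

theorem IsPrimeElem.exists_vertex_ge {p : M} (hp : IsPrimeElem p) {V : Type}
    (π : (V →₀ ℕ) →+ M) (α : V →₀ ℕ) (h : algLE p (π α)) :
    ∃ v α', α = Finsupp.single v 1 + α' ∧ algLE p (π (Finsupp.single v 1)) := by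
  induction α using Finsupp.induction_linear with
  | zero => exact absurd (by simpa using h) hp.not_le_zero
  | add f g hf hg =>
    rw [map_add] at h
    rcases hp.2 _ _ h with h | h
    · obtain ⟨v, α', rfl, hv⟩ := hf h
      exact ⟨v, α' + g, add_assoc _ _ _, hv⟩
    · obtain ⟨v, α', rfl, hv⟩ := hg h
      exact ⟨v, f + α', add_left_comm _ _ _, hv⟩
  | single v n =>
    cases n with
    | zero => exact absurd (by simpa using h) hp.not_le_zero
    | succ n =>
      refine ⟨v, Finsupp.single v n, by rw [← Finsupp.single_add, add_comm], ?_⟩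
      refine hp.of_le_nsmul (n := n + 1) ?_
      rwa [← map_nsmul, Finsupp.smul_single_one]

/-- A family `a` of elements equivalent to a free prime, together with a successor map `next`
and elements `t` such that `a v = a (next v) + t v`, for which equalities `a v + u = a v + u'`
are accounted for by the sums of `t` along the orbits of `next`. -/
structure OrbitSystem (p : M) (W : Type) (a t : W → M) (next : W → W) : Prop where
  le : ∀ v, algLE (a v) p
  ge : ∀ v, algLE p (a v)
  absorbed : ∀ v, algLE (p + t v) p
  eq_add : ∀ v, a v = a (next v) + t v
  exists_eq : ∀ v u u', algLE (p + u) p → algLE (p + u') p → a v + u = a v + u' →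
    ∃ n m : ℕ, next^[n] v = next^[m] v ∧
      u + ∑ i ∈ Finset.range n, t (next^[i] v) = u' + ∑ i ∈ Finset.range m, t (next^[i] v)

theorem exists_orbitSystem {p : M} (hp : IsPrimeElem p) (hfree : IsFreeElem p)
    {V : Type} {w : V → V →₀ ℕ} {π : (V →₀ ℕ) →+ M} (hsurj : Function.Surjective π)
    (hπ : ∀ α β, π α = π β ↔ addConGen (vertexRel w) α β) :
    ∃ (W : Type) (a t : W → M) (next : W → W), Nonempty W ∧ OrbitSystem p W a t next := by
  have hw : ∀ v, π (Finsupp.single v 1) = π (w v) := fun v =>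
    (hπ _ _).2 (AddConGen.Rel.of _ _ ⟨v, rfl, rfl⟩)
  let W := {v : V // algLE p (π (Finsupp.single v 1)) ∧ algLE (π (Finsupp.single v 1)) p}
  have hnext : ∀ v : W, ∃ (v' : W) (z : V →₀ ℕ), w v = Finsupp.single (v' : V) 1 + z := by
    rintro ⟨v, h1, h2⟩
    obtain ⟨v', z, hz, hv'⟩ := hp.exists_vertex_ge π (w v) (hw v ▸ h1)
    refine ⟨⟨v', hv', algLE.trans ?_ h2⟩, z, hz⟩
    rw [hw v, hz, map_add]
    exact algLE_add_right _ _
  choose next z hz using hnext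
  let a : W → M := fun v => π (Finsupp.single (v : V) 1)
  let t : W → M := fun v => π (z v)
  have heq : ∀ v, a v = a (next v) + t v := fun v => by
    rw [← map_add, ← hz, ← hw]
  have habs : ∀ v, algLE (p + t v) p := fun v =>
    (((next v).2.1.add (algLE.refl (t v))).trans (heq v ▸ algLE.refl _)).trans v.2.2
  refine ⟨W, a, t, next, ?_, fun v => v.2.2, fun v => v.2.1, habs, heq, ?_⟩
  · obtain ⟨α, hα⟩ := hsurj p
    obtain ⟨v, α', rfl, hv⟩ := hp.exists_vertex_ge π α (hα ▸ algLE.refl p)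
    exact ⟨⟨v, hv, by rw [← hα, map_add]; exact algLE_add_right _ _⟩⟩
  have key : ∀ (v : W) (ξ γ : V →₀ ℕ),
      Relation.ReflTransGen (vertexStep w) (Finsupp.single (v : V) 1 + ξ) γ →
      ∃ n ξ', γ = Finsupp.single (next^[n] v : V) 1 + ξ' ∧
        π ξ' = π ξ + ∑ i ∈ Finset.range n, t (next^[i] v) := by
    intro v ξ γ h
    induction h with
    | refl => exact ⟨0, ξ, rfl, by simp⟩
    | tail _ hstep ih =>
      obtain ⟨n, ξ', rfl, hξ'⟩ := ih
      obtain ⟨v', ρ, h, rfl⟩ := hstep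
      rcases single_add_eq_single_add h with ⟨rfl, rfl⟩ | ⟨σ, rfl, rfl⟩
      · refine ⟨n + 1, z (next^[n] v) + ξ', ?_, ?_⟩
        · rw [hz, Function.iterate_succ_apply', add_assoc]
        · rw [Finset.sum_range_succ, map_add, hξ', add_comm, add_assoc]
      · refine ⟨n, w v' + σ, add_left_comm _ _ _, ?_⟩
        rw [← hξ', map_add, map_add, hw]
  have hsumabs : ∀ (v : W) (u : M) (n : ℕ), algLE (p + u) p →
      algLE (p + (u + ∑ i ∈ Finset.range n, t (next^[i] v))) p := by
    intro v u n hu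
    induction n with
    | zero => simpa using hu
    | succ n ih =>
      rw [Finset.sum_range_succ, ← add_assoc u]
      exact absorbed_add ih (habs _)
  intro v u u' hu hu' h
  obtain ⟨ξ, rfl⟩ := hsurj u
  obtain ⟨ξ', rfl⟩ := hsurj u'
  have h' : π (Finsupp.single (v : V) 1 + ξ) = π (Finsupp.single (v : V) 1 + ξ') := by
    rw [map_add, map_add]
    exact h
  obtain ⟨γ, h1, h2⟩ := exists_common_reduct ((hπ _ _).1 h')
  obtain ⟨n, η, rfl, hη⟩ := key v ξ γ h1
  obtain ⟨m, η', hγ, hη'⟩ := key v ξ' _ h2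
  refine ⟨n, m, ?_⟩
  rcases single_add_eq_single_add hγ with ⟨hv, rfl⟩ | ⟨σ, rfl, -⟩
  · exact ⟨Subtype.ext hv, hη.symm.trans hη'⟩
  · refine absurd ?_ hfree.not_two_le
    refine absorbed_mono ?_ (hsumabs v (π ξ) n hu)
    rw [← hη, map_add]
    exact (next^[m] v).2.1.trans (algLE_add_right _ _)

namespace OrbitSystem

variable {p : M} {W : Type} {a t : W → M} {next : W → W} (h : OrbitSystem p W a t next)
include h

theorem eq_add_sum (v : W) (n : ℕ) :
    a v = a (next^[n] v) + ∑ i ∈ Finset.range n, t (next^[i] v) := by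
  induction n with
  | zero => simp
  | succ n ih =>
    rw [Finset.sum_range_succ, Function.iterate_succ_apply', add_comm (Finset.sum _ _),
      ← add_assoc, ← h.eq_add]
    exact ih

theorem sum_absorbed (v : W) (n : ℕ) :
    algLE (p + ∑ i ∈ Finset.range n, t (next^[i] v)) p := by
  induction n with
  | zero => simpa using algLE.refl p
  | succ n ih =>
    rw [Finset.sum_range_succ]
    exact absorbed_add ih (h.absorbed _)

theorem absorbed_iff (v : W) (u : M) : algLE (a v + u) (a v) ↔ algLE (p + u) p :=
  ⟨fun hu => (((h.ge v).add (algLE.refl u)).trans hu).trans (h.le v),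
    fun hu => (((h.le v).add (algLE.refl u)).trans hu).trans (h.ge v)⟩

theorem absorbed_of_eq {v : W} {u u' : M} (hu : algLE (a v + u) (a v)) (he : a v + u = a v + u') :
    algLE (p + u) p ∧ algLE (p + u') p :=
  ⟨(h.absorbed_iff v u).1 hu, (h.absorbed_iff v u').1 (he ▸ hu)⟩

theorem exists_orderUnit [AddMonoid.FG M] (v : W) :
    ∃ x, a v + x = a v ∧ ∀ z, algLE (p + z) p → ∃ k : ℕ, algLE z (k • x) := by
  obtain ⟨s, hs, hunit⟩ := ArPardo.exists_orderUnit (isOrderIdeal_absorbed (a v))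
  obtain ⟨τ, hτ⟩ := hs
  refine ⟨s + τ, by rw [← add_assoc]; exact hτ.symm, fun z hz => ?_⟩
  obtain ⟨k, hk⟩ := hunit z ((h.absorbed_iff v z).2 hz)
  exact ⟨k, hk.trans ((algLE_add_right s τ).nsmul k)⟩

theorem absorptionCyclic_of_injective [AddMonoid.FG M] (v : W)
    (hinj : ∀ n m, next^[n] v = next^[m] v → n = m) : AbsorptionCyclic (a v) := by
  obtain ⟨x, hx, hunit⟩ := h.exists_orderUnit v
  obtain ⟨hx0, h0⟩ := h.absorbed_of_eq (u := x) (u' := 0) (v := v)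
    (by rw [hx]; exact algLE.refl _) (by rw [hx, add_zero])
  obtain ⟨n, m, hnm, hxy⟩ := h.exists_eq v x 0 hx0 h0 (by rw [hx, add_zero])
  obtain rfl := hinj n m hnm
  have hyabs := h.sum_absorbed v n
  have hav := h.eq_add_sum v n
  generalize ∑ i ∈ Finset.range n, t (next^[i] v) = y at *
  rw [zero_add] at hxy
  have hkx : ∀ k : ℕ, y + k • x = y := fun k => by
    induction k with
    | zero => simp
    | succ k ih => rw [succ_nsmul, ← add_assoc, ih, add_comm, hxy]
  obtain ⟨k, hk⟩ := hunit y hyabs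
  obtain ⟨e, hee, hye, hle, -⟩ := exists_idempotent (x := y) (by
    conv_rhs => rw [← hkx k]
    exact (algLE.refl y).add hk)
  have hxe : algLE x e := by
    rw [← hxy] at hle
    exact (algLE_add_right x y).trans hle
  refine ⟨e, by rw [hav, add_assoc, hye], fun z hz => ?_, fun u u' hu heq => ?_⟩
  · obtain ⟨k, hk⟩ := hunit z ((h.absorbed_iff v z).1 hz)
    exact ⟨k, hk.trans (hxe.nsmul k)⟩
  · obtain ⟨hu, hu'⟩ := h.absorbed_of_eq hu heq
    obtain ⟨i, j, hij, huv⟩ := h.exists_eq v u u' hu hu' heq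
    obtain rfl := hinj i j hij
    obtain ⟨k, hk⟩ := hunit _ (h.sum_absorbed v i)
    obtain ⟨r, hr⟩ := hk.trans (hxe.nsmul k)
    refine ⟨k, k, ?_⟩
    rw [hr, ← add_assoc, huv, add_assoc]

omit h in
theorem sum_iterate_eq (v : W) (n : ℕ) :
    ∑ i ∈ Finset.range n, t (next^[i] v) =
      (n / Function.minimalPeriod next v) •
        ∑ i ∈ Finset.range (Function.minimalPeriod next v), t (next^[i] v) +
      ∑ i ∈ Finset.range (n % Function.minimalPeriod next v), t (next^[i] v) := by
  have hshift : ∀ k r : ℕ, ∑ i ∈ Finset.range (Function.minimalPeriod next v * k + r),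
      t (next^[i] v) = k • ∑ i ∈ Finset.range (Function.minimalPeriod next v), t (next^[i] v) +
        ∑ i ∈ Finset.range r, t (next^[i] v) := by
    intro k r
    induction k with
    | zero => simp
    | succ k ih =>
      rw [mul_add, mul_one, add_comm (_ * k), add_assoc, Finset.sum_range_add, succ_nsmul',
        add_assoc, ← ih]
      congr 1
      refine Finset.sum_congr rfl fun i _ => ?_
      rw [add_comm, Function.iterate_add_apply, Function.iterate_minimalPeriod]
  conv_lhs => rw [← Nat.div_add_mod n (Function.minimalPeriod next v)]
  exact hshift _ _

theorem absorptionCyclic_of_periodic [AddMonoid.FG M] (v : W)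
    (hper : v ∈ Function.periodicPts next) : AbsorptionCyclic (a v) := by
  have hT := Function.minimalPeriod_pos_of_mem_periodicPts hper
  have hcancel : ∀ u u', algLE (p + u) p → algLE (p + u') p → a v + u = a v + u' →
      ∃ n m : ℕ, u + n • ∑ i ∈ Finset.range (Function.minimalPeriod next v), t (next^[i] v) =
        u' + m • ∑ i ∈ Finset.range (Function.minimalPeriod next v), t (next^[i] v) := by
    intro u u' hu hu' heq
    obtain ⟨n, m, hnm, huv⟩ := h.exists_eq v u u' hu hu' heq
    rw [← Function.iterate_mod_minimalPeriod_eq, ← Function.iterate_mod_minimalPeriod_eq (n := m),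
      Function.iterate_eq_iterate_iff_of_lt_minimalPeriod (Nat.mod_lt _ hT) (Nat.mod_lt _ hT)]
      at hnm
    rw [sum_iterate_eq v n, sum_iterate_eq v m, hnm] at huv
    have hlt := Nat.mod_lt m hT
    obtain ⟨d, hd⟩ := Nat.exists_eq_add_of_le hlt.le
    obtain ⟨r, hx⟩ : ∃ r, ∑ i ∈ Finset.range (Function.minimalPeriod next v), t (next^[i] v) =
        ∑ i ∈ Finset.range (m % Function.minimalPeriod next v), t (next^[i] v) + r :=
      ⟨_, (congrArg (fun k => ∑ i ∈ Finset.range k, t (next^[i] v)) hd).trans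
        (Finset.sum_range_add _ _ _)⟩
    refine ⟨n / Function.minimalPeriod next v + 1, m / Function.minimalPeriod next v + 1, ?_⟩
    rw [add_nsmul, add_nsmul, one_nsmul]
    generalize ∑ i ∈ Finset.range (m % Function.minimalPeriod next v), t (next^[i] v) = y at *
    generalize ∑ i ∈ Finset.range (Function.minimalPeriod next v), t (next^[i] v) = x at *
    calc _ = u + ((n / Function.minimalPeriod next v) • x + y) + r := by
          conv_lhs => rhs; rhs; rw [hx]
          abel
      _ = u' + ((m / Function.minimalPeriod next v) • x + y) + r := by rw [huv]
      _ = _ := by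
          conv_rhs => rhs; rhs; rw [hx]
          abel
  have hav := h.eq_add_sum v (Function.minimalPeriod next v)
  rw [Function.iterate_minimalPeriod] at hav
  generalize ∑ i ∈ Finset.range (Function.minimalPeriod next v), t (next^[i] v) = y at *
  refine ⟨y, hav.symm, fun z hz => ?_, fun u u' hu heq => ?_⟩
  · obtain ⟨x, hx, hunit⟩ := h.exists_orderUnit v
    obtain ⟨hx0, h0⟩ := h.absorbed_of_eq (u := x) (u' := 0) (v := v)
      (by rw [hx]; exact algLE.refl _) (by rw [hx, add_zero])
    obtain ⟨n, m, hnm⟩ := hcancel x 0 hx0 h0 (by rw [hx, add_zero])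
    obtain ⟨k, hk⟩ := hunit z ((h.absorbed_iff v z).1 hz)
    refine ⟨k * m, hk.trans ?_⟩
    rw [mul_comm, mul_nsmul]
    refine algLE.nsmul ?_ k
    rw [← zero_add (m • y), ← hnm]
    exact algLE_add_right _ _
  · obtain ⟨hu, hu'⟩ := h.absorbed_of_eq hu heq
    exact hcancel u u' hu hu' heq

theorem absorptionCyclic [AddMonoid.FG M] [Nonempty W] : AbsorptionCyclic p := by
  obtain ⟨v⟩ := ‹Nonempty W›
  by_cases hinj : ∀ n m, next^[n] v = next^[m] v → n = m
  · exact (h.absorptionCyclic_of_injective v hinj).congr (h.le v) (h.ge v)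
  · have : ∃ n, next^[n] v ∈ Function.periodicPts next := by
      push Not at hinj
      obtain ⟨n, m, hnm, hne⟩ := hinj
      wlog hlt : n < m generalizing n m
      · exact this m n hnm.symm hne.symm (by omega)
      refine ⟨n, Function.mk_mem_periodicPts (n := m - n) (by omega) ?_⟩
      rw [Function.IsPeriodicPt, Function.IsFixedPt, ← Function.iterate_add_apply,
        Nat.sub_add_cancel hlt.le, hnm]
    obtain ⟨n, hn⟩ := this
    exact (h.absorptionCyclic_of_periodic _ hn).congr (h.le _) (h.ge _)

end OrbitSystem

theorem IsGraphMonoid.absorptionCyclic [AddMonoid.FG M] (h : IsGraphMonoid M) {p : M}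
    (hp : IsPrimeElem p) (hfree : IsFreeElem p) : AbsorptionCyclic p := by
  obtain ⟨V, w, π, hsurj, hπ⟩ := h.exists_presentation
  obtain ⟨W, a, t, next, hW, hsys⟩ := exists_orbitSystem hp hfree hsurj hπ
  exact hsys.absorptionCyclic

end FreeVertices

section Construction

open Finsupp (linearCombination single mapDomain)

variable {M : Type} [AddCommMonoid M]

/-- The order ideal `N` is presented by generators `f v` and relations `f v = w v`. -/
structure IsPresentation (N : Set M) {V : Type} (f : V → M) (w : V → V →₀ ℕ) : Prop where
  ne_zero : ∀ v, w v ≠ 0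
  range_eq : Set.range (linearCombination ℕ f) = N
  rel : ∀ v, linearCombination ℕ f (w v) = f v
  inj : ∀ α β, linearCombination ℕ f α = linearCombination ℕ f β → addConGen (vertexRel w) α β

theorem IsPresentation.isGraphMonoid {V : Type} [Countable V] {f : V → M} {w : V → V →₀ ℕ}
    (h : IsPresentation Set.univ f w) : IsGraphMonoid M := by
  refine isGraphMonoid_of_presentation w h.ne_zero (linearCombination ℕ f).toAddMonoidHom
    (Set.range_eq_univ.1 h.range_eq) fun α β => ⟨h.inj α β, fun hαβ => ?_⟩
  have hle : addConGen (vertexRel w) ≤ AddCon.ker (linearCombination ℕ f).toAddMonoidHom := by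
    refine AddCon.addConGen_le.2 ?_
    rintro x y ⟨v, rfl, rfl⟩
    refine (AddCon.ker_rel _).2 ?_
    simp [h.rel]
  exact (AddCon.ker_rel _).1 (hle hαβ)

section Extension

variable {V U : Type} {w : V → V →₀ ℕ} (w' : U → (V ⊕ U) →₀ ℕ)

/-- The relations `w` on `V` together with further relations `w'` for the new vertices `U`. -/
noncomputable def extendRel (w : V → V →₀ ℕ) (w' : U → (V ⊕ U) →₀ ℕ) :
    V ⊕ U → (V ⊕ U) →₀ ℕ :=
  Sum.elim (fun v => mapDomain Sum.inl (w v)) w'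

theorem mk_single_inr (u : U) :
    (addConGen (vertexRel (extendRel w w'))).mk' (single (Sum.inr u) 1) =
      (addConGen (vertexRel (extendRel w w'))).mk' (w' u) :=
  (AddCon.eq _).2 (AddConGen.Rel.of _ _ ⟨Sum.inr u, rfl, rfl⟩)

theorem mk_mapDomain_inl {α β : V →₀ ℕ} (h : addConGen (vertexRel w) α β) :
    (addConGen (vertexRel (extendRel w w'))).mk' (mapDomain Sum.inl α) =
      (addConGen (vertexRel (extendRel w w'))).mk' (mapDomain Sum.inl β) := by
  refine (AddCon.eq _).2 ?_
  have hle : addConGen (vertexRel w) ≤ AddCon.comap (mapDomain Sum.inl)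
      (fun _ _ => Finsupp.mapDomain_add) (addConGen (vertexRel (extendRel w w'))) := by
    refine AddCon.addConGen_le.2 ?_
    rintro x y ⟨v, rfl, rfl⟩
    refine AddConGen.Rel.of _ _ ⟨Sum.inl v, ?_, rfl⟩
    rw [Finsupp.mapDomain_single]
  exact hle h

omit w w' in
theorem exists_eq_mapDomain_add (η : (V ⊕ U) →₀ ℕ) :
    ∃ (α : V →₀ ℕ) (δ : U →₀ ℕ), η = mapDomain Sum.inl α + mapDomain Sum.inr δ := by
  induction η using Finsupp.induction_linear with
  | zero => exact ⟨0, 0, by simp⟩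
  | add η η' h h' =>
    obtain ⟨α, δ, rfl⟩ := h
    obtain ⟨α', δ', rfl⟩ := h'
    exact ⟨α + α', δ + δ', by rw [Finsupp.mapDomain_add, Finsupp.mapDomain_add]; abel⟩
  | single v n =>
    rcases v with v | u
    · exact ⟨single v n, 0, by simp [Finsupp.mapDomain_single]⟩
    · exact ⟨0, single u n, by simp [Finsupp.mapDomain_single]⟩

omit w w' in
theorem linearCombination_elim_inl (f : V → M) (g : U → M) (α : V →₀ ℕ) :
    linearCombination ℕ (Sum.elim f g) (mapDomain Sum.inl α) = linearCombination ℕ f α := by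
  rw [Finsupp.linearCombination_mapDomain, Sum.elim_comp_inl]

omit w w' in
theorem linearCombination_elim_inr (f : V → M) (g : U → M) (δ : U →₀ ℕ) :
    linearCombination ℕ (Sum.elim f g) (mapDomain Sum.inr δ) = linearCombination ℕ g δ := by
  rw [Finsupp.linearCombination_mapDomain, Sum.elim_comp_inr]

end Extension

section FreeStep

variable {N : Set M} (hN : IsOrderIdeal N) (href : IsRefinement M) {p : M} (hp : IsPrimeElem p)
  (hpN : p ∉ N) (habs : ∀ u, algLE (p + u) p → u ∈ N)
include hN href hp habs

theorem isOrderIdeal_add_nsmul : IsOrderIdeal {y | ∃ n ∈ N, ∃ k : ℕ, y = n + k • p} := by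
  refine ⟨⟨0, hN.1, 0, by simp⟩, ?_, ?_⟩
  · rintro _ _ ⟨n, hn, k, rfl⟩ ⟨n', hn', k', rfl⟩
    exact ⟨n + n', hN.2.1 _ _ hn hn', k + k', by rw [add_nsmul]; abel⟩
  · rintro y _ ⟨z, hz⟩ ⟨n, hn, k, rfl⟩
    induction k generalizing y z with
    | zero => exact ⟨y, hN.2.2 y n ⟨z, by simpa using hz⟩ hn, 0, by simp⟩
    | succ k ih =>
      rw [succ_nsmul, ← add_assoc] at hz
      obtain ⟨a, x, c, d, h1, h2, rfl, rfl⟩ := href _ _ _ _ hz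
      obtain ⟨n', hn', k', rfl⟩ := ih a x h1
      rcases hp.2 c d (h2 ▸ algLE.refl p) with ⟨r, rfl⟩ | ⟨r, rfl⟩
      · refine ⟨n' + r, hN.2.1 _ _ hn' (habs r ?_), k' + 1, by rw [succ_nsmul]; abel⟩
        conv_rhs => rw [h2]
        exact algLE_add_right _ _
      · refine ⟨n' + c, hN.2.1 _ _ hn' (habs c ⟨r, ?_⟩), k', by abel⟩
        conv_lhs => rw [h2]
        abel

include hpN

theorem add_nsmul_eq_add_nsmul {x : M} (hunit : ∀ z : M, algLE (p + z) p → ∃ k : ℕ, algLE z (k • x))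
    (hker : ∀ u v : M, algLE (p + u) p → p + u = p + v → ∃ n m : ℕ, u + n • x = v + m • x)
    (k k' : ℕ) {n n' : M} (hn : n ∈ N) (hn' : n' ∈ N) (h : n + k • p = n' + k' • p) :
    k = k' ∧ (k = 0 → n = n') ∧ ∃ i j : ℕ, n + i • x = n' + j • x := by
  have hnot : ∀ {n n' : M} {k : ℕ}, n ∈ N → n ≠ n' + (k + 1) • p := fun {n n' k} hn h => by
    refine hpN (hN.2.2 p n ⟨n' + k • p, ?_⟩ hn)
    rw [h, succ_nsmul]
    abel
  induction k generalizing k' n n' with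
  | zero =>
    rw [zero_nsmul, add_zero] at h
    cases k' with
    | zero =>
      rw [zero_nsmul, add_zero] at h
      exact ⟨rfl, fun _ => h, 0, 0, by rw [h]⟩
    | succ k' => exact absurd h (hnot hn)
  | succ k ih =>
    cases k' with
    | zero =>
      rw [zero_nsmul, add_zero] at h
      exact absurd h.symm (hnot hn')
    | succ k' =>
      rw [succ_nsmul', succ_nsmul', add_left_comm, add_left_comm n'] at h
      obtain ⟨a, b, c, d, h1, h2, h3, h4⟩ := href _ _ _ _ h
      suffices k = k' ∧ ∃ i j : ℕ, n + i • x = n' + j • x from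
        ⟨by rw [this.1], fun h0 => absurd h0 (Nat.succ_ne_zero k), this.2⟩
      by_cases hpa : algLE p a
      · obtain ⟨r, rfl⟩ := hpa
        have hb : algLE (p + b) p := by
          conv_rhs => rw [h1]
          exact ⟨r, by abel⟩
        have hc : algLE (p + c) p := by
          conv_rhs => rw [h3]
          exact ⟨r, by abel⟩
        have hbc : p + b = p + c := add_eq_of_add_add_eq h1.symm h3.symm
        obtain ⟨hk, -, i, j, hij⟩ := ih k' (hN.2.1 _ _ hn (habs b hb)) (hN.2.1 _ _ hn' (habs c hc))
          (by rw [add_right_comm, h2, add_right_comm n', h4]; abel)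
        obtain ⟨i', j', hij'⟩ := hker b c hb hbc
        obtain ⟨l, s, hs⟩ := hunit c hc
        refine ⟨hk, l + j' + i, l + j + i', ?_⟩
        calc n + (l + j' + i) • x = n + (c + j' • x) + i • x + s := by
              rw [add_nsmul, add_nsmul, hs]; abel
          _ = (n + b + i • x) + i' • x + s := by rw [← hij']; abel
          _ = n' + (c + s) + j • x + i' • x := by rw [hij]; abel
          _ = n' + (l + j + i') • x := by rw [← hs, add_nsmul, add_nsmul]; abel
      · obtain ⟨b, rfl⟩ := (hp.2 a b (h1 ▸ algLE.refl p)).resolve_left hpa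
        obtain ⟨c, rfl⟩ := (hp.2 a c (h3 ▸ algLE.refl p)).resolve_left hpa
        have hbc : p + b = p + c := add_eq_of_add_add_eq (w := a)
          (by conv_rhs => rw [h1]
              abel) (by conv_rhs => rw [h3]
                        abel)
        obtain ⟨hk, -, hij⟩ := ih k' hn hn' (by rw [h2, h4, hbc])
        exact ⟨hk, hij⟩

theorem IsPresentation.adjoin_free {V : Type} {f : V → M} {w : V → V →₀ ℕ}
    (h : IsPresentation N f w) (hcyc : AbsorptionCyclic p) :
    ∃ w' : Unit → (V ⊕ Unit) →₀ ℕ, IsPresentation {y | ∃ n ∈ N, ∃ k : ℕ, y = n + k • p}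
      (Sum.elim f fun _ => p) (extendRel w w') := by
  obtain ⟨x, hx, hunit, hker⟩ := hcyc
  obtain ⟨ξ, rfl⟩ : x ∈ Set.range (linearCombination ℕ f) :=
    h.range_eq ▸ habs x (by rw [hx]; exact algLE.refl p)
  have hmem : ∀ α, linearCombination ℕ f α ∈ N := fun α => h.range_eq ▸ ⟨α, rfl⟩
  have hform : ∀ η : (V ⊕ Unit) →₀ ℕ, ∃ (α : V →₀ ℕ) (k : ℕ),
      η = mapDomain Sum.inl α + k • single (Sum.inr ()) 1 := by
    intro η
    obtain ⟨α, δ, rfl⟩ := exists_eq_mapDomain_add η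
    refine ⟨α, δ (), ?_⟩
    conv_lhs => rw [Finsupp.unique_single δ, Finsupp.mapDomain_single]
    rw [Finsupp.smul_single_one]
  have heval : ∀ (α : V →₀ ℕ) (k : ℕ), linearCombination ℕ (Sum.elim f fun _ : Unit => p)
      (mapDomain Sum.inl α + k • single (Sum.inr ()) 1) = linearCombination ℕ f α + k • p := by
    intro α k
    rw [map_add, linearCombination_elim_inl, map_nsmul, Finsupp.linearCombination_single, one_smul]
    rfl
  let w' : Unit → (V ⊕ Unit) →₀ ℕ := fun _ => mapDomain Sum.inl ξ + single (Sum.inr ()) 1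
  refine ⟨w', ?_, ?_, ?_, ?_⟩
  · rintro (v | u)
    · exact fun h0 => h.ne_zero v
        (Finsupp.mapDomain_injective Sum.inl_injective (h0.trans Finsupp.mapDomain_zero.symm))
    · intro h0
      have := DFunLike.congr_fun h0 (Sum.inr ())
      simp [extendRel, w'] at this
  · ext y
    constructor
    · rintro ⟨η, rfl⟩
      obtain ⟨α, k, rfl⟩ := hform η
      exact ⟨_, hmem α, k, heval α k⟩
    · rintro ⟨n, hn, k, rfl⟩
      rw [← h.range_eq] at hn
      obtain ⟨α, rfl⟩ := hn
      exact ⟨_, heval α k⟩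
  · rintro (v | u)
    · exact (linearCombination_elim_inl _ _ _).trans (h.rel v)
    · have := heval ξ 1
      rw [one_nsmul, one_nsmul, add_comm _ p, hx] at this
      exact this
  · intro η η' heq
    obtain ⟨α, k, rfl⟩ := hform η
    obtain ⟨β, k', rfl⟩ := hform η'
    rw [heval, heval] at heq
    obtain ⟨rfl, h0, i, j, hij⟩ :=
      add_nsmul_eq_add_nsmul hN href hp hpN habs hunit hker k k' (hmem α) (hmem β) heq
    rw [← AddCon.eq]
    change (addConGen (vertexRel (extendRel w w'))).mk' _ =
      (addConGen (vertexRel (extendRel w w'))).mk' _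
    rw [map_add, map_add]
    cases k with
    | zero => rw [mk_mapDomain_inl w' (h.inj α β (h0 rfl))]
    | succ k =>
      have hv := mk_single_inr (w := w) w' ()
      have hiter : ∀ i : ℕ, (addConGen (vertexRel (extendRel w w'))).mk' (single (Sum.inr ()) 1) =
          (addConGen (vertexRel (extendRel w w'))).mk' (mapDomain Sum.inl (i • ξ)) +
          (addConGen (vertexRel (extendRel w w'))).mk' (single (Sum.inr ()) 1) := by
        intro i
        induction i with
        | zero => simp
        | succ i ih =>
          conv_lhs => rw [ih, hv]
          rw [succ_nsmul, Finsupp.mapDomain_add, map_add, map_add, ← add_assoc]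
      have hαβ := mk_mapDomain_inl w' (h.inj (α + i • ξ) (β + j • ξ) (by
        rw [map_add, map_add, map_nsmul, map_nsmul, hij]))
      rw [Finsupp.mapDomain_add, Finsupp.mapDomain_add, map_add, map_add] at hαβ
      rw [succ_nsmul', map_add]
      conv_lhs => rw [hiter i, add_assoc, ← add_assoc, hαβ]
      conv_rhs => rw [hiter j, add_assoc, ← add_assoc]

end FreeStep

section RegularStep

section Absorption

variable {V : Type} {w : V → V →₀ ℕ} (c t : ℕ → (V ⊕ ℕ) →₀ ℕ)

/-- The relations for the vertices of an idempotent prime: `v = v + c i` for `v = 2 * i` and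
`v = v + (c i + t i)` for `v = 2 * i + 1`. -/
noncomputable def regularRel (j : ℕ) : (V ⊕ ℕ) →₀ ℕ :=
  single (Sum.inr j) 1 + if Even j then c (j / 2) else c (j / 2) + t (j / 2)

theorem regularRel_even (i : ℕ) :
    regularRel c t (2 * i) = single (Sum.inr (2 * i)) 1 + c i := by
  simp [regularRel]

theorem regularRel_odd (i : ℕ) :
    regularRel c t (2 * i + 1) = single (Sum.inr (2 * i + 1)) 1 + (c i + t i) := by
  have h1 : ¬ Even (2 * i + 1) := by simp
  have h2 : (2 * i + 1) / 2 = i := by omega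
  rw [regularRel, if_neg h1, h2]

theorem mk_add_eq_mk (hc : ∀ i, ∃ r, c i = single (Sum.inr 0) 1 + single (Sum.inr (2 * i + 1)) 1 +
      single (Sum.inr (2 * i + 2)) 1 + r) (j i : ℕ) :
    (addConGen (vertexRel (extendRel w (regularRel c t)))).mk' (single (Sum.inr j) 1) +
      (addConGen (vertexRel (extendRel w (regularRel c t)))).mk' (t i) =
    (addConGen (vertexRel (extendRel w (regularRel c t)))).mk' (single (Sum.inr j) 1) := by
  have hmk := mk_single_inr (w := w) (regularRel c t)
  generalize (addConGen (vertexRel (extendRel w (regularRel c t)))).mk' = ρ at hmk ⊢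
  have heven : ∀ i, ρ (single (Sum.inr (2 * i)) 1) = ρ (single (Sum.inr (2 * i)) 1) + ρ (c i) :=
    fun i => by
      conv_lhs => rw [hmk, regularRel_even, map_add]
  have hodd : ∀ i, ρ (single (Sum.inr (2 * i + 1)) 1) =
      ρ (single (Sum.inr (2 * i + 1)) 1) + (ρ (c i) + ρ (t i)) := fun i => by
    conv_lhs => rw [hmk, regularRel_odd, map_add, map_add]
  choose r hr using hc
  have hlec : ∀ j, ∃ s, ρ (single (Sum.inr j) 1) = ρ (c (j / 2)) + s := by
    intro j
    obtain ⟨i, rfl | rfl⟩ := j.even_or_odd'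
    · rw [Nat.mul_div_cancel_left i two_pos]
      exact ⟨_, (heven i).trans (add_comm _ _)⟩
    · have h2 : (2 * i + 1) / 2 = i := by omega
      rw [h2]
      exact ⟨ρ (single (Sum.inr (2 * i + 1)) 1) + ρ (t i), (hodd i).trans (by abel)⟩
  have hzero : ∀ j, ∃ s, ρ (single (Sum.inr j) 1) = ρ (single (Sum.inr 0) 1) + s := fun j => by
    obtain ⟨s, hs⟩ := hlec j
    refine ⟨ρ (single (Sum.inr (2 * (j / 2) + 1)) 1) + ρ (single (Sum.inr (2 * (j / 2) + 2)) 1) +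
      ρ (r (j / 2)) + s, hs.trans ?_⟩
    rw [hr, map_add, map_add, map_add]
    abel
  have hsucc : ∀ j, ∃ s, ρ (single (Sum.inr j) 1) = ρ (single (Sum.inr (j + 1)) 1) + s := fun j => by
    obtain ⟨s, hs⟩ := hlec j
    rw [hr, map_add, map_add, map_add] at hs
    obtain ⟨i, rfl | rfl⟩ := j.even_or_odd'
    · rw [Nat.mul_div_cancel_left i two_pos] at hs
      exact ⟨ρ (single (Sum.inr 0) 1) + ρ (single (Sum.inr (2 * i + 2)) 1) + ρ (r i) + s,
        hs.trans (by abel)⟩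
    · have h2 : (2 * i + 1) / 2 = i := by omega
      rw [h2] at hs
      exact ⟨ρ (single (Sum.inr 0) 1) + ρ (single (Sum.inr (2 * i + 1)) 1) + ρ (r i) + s,
        hs.trans (by abel)⟩
  have hle : ∀ j k, ∃ s, ρ (single (Sum.inr j) 1) = ρ (single (Sum.inr k) 1) + s := fun j k => by
    induction k with
    | zero => exact hzero j
    | succ k ih =>
      obtain ⟨s, hs⟩ := ih
      obtain ⟨s', hs'⟩ := hsucc k
      exact ⟨s' + s, by rw [hs, hs', add_assoc]⟩
  obtain ⟨s, hs⟩ := hle j (2 * i)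
  have hci : ρ (single (Sum.inr j) 1) + ρ (c i) = ρ (single (Sum.inr j) 1) := by
    rw [hs, add_right_comm, ← heven]
  obtain ⟨s, hs⟩ := hle j (2 * i + 1)
  conv_lhs => rw [← hci]
  rw [hs, add_assoc, add_right_comm, ← hodd]

end Absorption

variable {N : Set M} (hN : IsOrderIdeal N) (href : IsRefinement M) {p : M} (hpp : p + p = p)
include hN href hpp

theorem isOrderIdeal_union_add (hlt : ∀ z, classLT z p → z ∈ N) :
    IsOrderIdeal {y | y ∈ N ∨ ∃ n ∈ N, ∃ g, (algLE p g ∧ algLE g p) ∧ y = n + g} := by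
  refine ⟨Or.inl hN.1, ?_, ?_⟩
  · rintro x y (hx | ⟨n, hn, g, hg, rfl⟩) (hy | ⟨n', hn', g', hg', rfl⟩)
    · exact Or.inl (hN.2.1 _ _ hx hy)
    · exact Or.inr ⟨x + n', hN.2.1 _ _ hx hn', g', hg', by abel⟩
    · exact Or.inr ⟨n + y, hN.2.1 _ _ hn hy, g, hg, by abel⟩
    · refine Or.inr ⟨n + n', hN.2.1 _ _ hn hn', g + g',
        ⟨hg.1.trans (algLE_add_right _ _), ?_⟩, by abel⟩
      rw [← hpp]
      exact hg.2.add hg'.2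
  · rintro y _ hy (hx | ⟨n, hn, g, hg, rfl⟩)
    · exact Or.inl (hN.2.2 _ _ hy hx)
    · obtain ⟨z, hz⟩ := hy
      obtain ⟨a, b, c, d, rfl, rfl, rfl, -⟩ := href _ _ _ _ hz
      have ha : a ∈ N := hN.2.2 _ _ (algLE_add_right a b) hn
      have hcp : algLE c p := (algLE_add_right c d).trans hg.2
      by_cases hpc : algLE p c
      · exact Or.inr ⟨a, ha, c, ⟨hpc, hcp⟩, rfl⟩
      · exact Or.inl (hN.2.1 _ _ ha (hlt c ⟨hcp, hpc⟩))

theorem IsPresentation.adjoin_regular (hpN : p ∉ N) [Countable M] {V : Type}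
    {f : V → M} {w : V → V →₀ ℕ}
    [Countable V] (h : IsPresentation N f w) :
    ∃ (g : ℕ → M) (w' : ℕ → (V ⊕ ℕ) →₀ ℕ),
      IsPresentation {y | y ∈ N ∨ ∃ n ∈ N, ∃ g, (algLE p g ∧ algLE g p) ∧ y = n + g}
        (Sum.elim f g) (extendRel w w') := by
  have habsorb : ∀ {y}, algLE p y → p + y = y := by
    rintro _ ⟨z, rfl⟩
    rw [← add_assoc, hpp]
  have hadd : ∀ {y z}, algLE y p → algLE z p → algLE (y + z) p := fun {y z} hy hz => by
    have := hy.add hz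
    rwa [hpp] at this
  have hmem : ∀ α, linearCombination ℕ f α ∈ N := fun α => h.range_eq ▸ ⟨α, rfl⟩
  have : Nonempty {g : M // algLE p g ∧ algLE g p} := ⟨⟨p, algLE.refl p, algLE.refl p⟩⟩
  obtain ⟨g, hg⟩ := exists_surjective_nat {g : M // algLE p g ∧ algLE g p}
  have hinv : ∀ y, algLE p y → algLE y p → ∃ k, (g k : M) + y = p := by
    rintro y hpy ⟨z, hz⟩
    have hzp : algLE (p + z) p := by
      refine ⟨y, ?_⟩
      calc p = p + p := hpp.symm
        _ = p + z + y := by conv_lhs => rhs; rw [hz]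
                            abel
    obtain ⟨k, hk⟩ := hg ⟨p + z, algLE_add_right p z, hzp⟩
    refine ⟨k, ?_⟩
    rw [hk]
    change p + z + y = p
    rw [add_assoc, add_comm z, ← hz, hpp]
  let F : (V ⊕ ℕ) → M := Sum.elim f fun k => (g k : M)
  have hFinr : ∀ k, linearCombination ℕ F (single (Sum.inr k) 1) = g k := fun k => by
    rw [Finsupp.linearCombination_single, one_smul]
    rfl
  let T := {t : (V ⊕ ℕ) →₀ ℕ // p + linearCombination ℕ F t = p}
  have : Nonempty T := ⟨⟨0, by simp⟩⟩
  obtain ⟨t, ht⟩ := exists_surjective_nat T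
  have hcex : ∀ i : ℕ, ∃ c : (V ⊕ ℕ) →₀ ℕ, (∃ r, c = single (Sum.inr 0) 1 +
      single (Sum.inr (2 * i + 1)) 1 + single (Sum.inr (2 * i + 2)) 1 + r) ∧
      linearCombination ℕ F c = p := by
    intro i
    obtain ⟨k, hk⟩ := hinv (g 0 + g (2 * i + 1) + g (2 * i + 2))
      ((g 0).2.1.trans ((algLE_add_right _ _).trans (algLE_add_right _ _)))
      (hadd (hadd (g 0).2.2 (g _).2.2) (g _).2.2)
    refine ⟨_, ⟨single (Sum.inr k) 1, rfl⟩, ?_⟩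
    rw [map_add, map_add, map_add, hFinr, hFinr, hFinr, hFinr, add_comm]
    exact hk
  choose c hc hcp using hcex
  have hrelp : ∀ j, linearCombination ℕ F (regularRel c (fun i => (t i).1) j) = g j := by
    intro j
    have hgj := habsorb (g j).2.1
    rw [regularRel, map_add, hFinr]
    split_ifs
    · rw [hcp, add_comm, hgj]
    · rw [map_add, hcp, (t _).2, add_comm, hgj]
  have hgenle : ∀ δ : ℕ →₀ ℕ, algLE (linearCombination ℕ (fun k => (g k : M)) δ) p := fun δ => by
    have h0 : algLE 0 p := ⟨p, (zero_add p).symm⟩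
    induction δ using Finsupp.induction_linear with
    | zero => simpa using h0
    | add δ δ' h h' => rw [map_add]; exact hadd h h'
    | single k n =>
      rw [Finsupp.linearCombination_single]
      induction n with
      | zero => simpa using h0
      | succ n ih => rw [succ_nsmul]; exact hadd ih (g k).2.2
  have hgen : ∀ δ : ℕ →₀ ℕ, δ ≠ 0 → (∃ j r, δ = single j 1 + r) ∧
      algLE p (linearCombination ℕ (fun k => (g k : M)) δ) := by
    intro δ hδ
    obtain ⟨j, hj⟩ := DFunLike.ne_iff.1 hδ
    obtain ⟨r, rfl⟩ := exists_add_of_le (Finsupp.single_le_iff.2 (Nat.one_le_iff_ne_zero.2 hj))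
    refine ⟨⟨j, r, rfl⟩, ?_⟩
    rw [map_add, Finsupp.linearCombination_single, one_smul]
    exact (g j).2.1.trans (algLE_add_right _ _)
  have heval : ∀ (α : V →₀ ℕ) (δ : ℕ →₀ ℕ),
      linearCombination ℕ F (mapDomain Sum.inl α + mapDomain Sum.inr δ) =
        linearCombination ℕ f α + linearCombination ℕ (fun k => (g k : M)) δ := fun α δ => by
    rw [map_add, linearCombination_elim_inl, linearCombination_elim_inr]
  let w' := regularRel c fun i => (t i).1
  have habsorb' : ∀ j τ, p + linearCombination ℕ F τ = p →
      (addConGen (vertexRel (extendRel w w'))).mk' (single (Sum.inr j) 1) +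
        (addConGen (vertexRel (extendRel w w'))).mk' τ =
      (addConGen (vertexRel (extendRel w w'))).mk' (single (Sum.inr j) 1) := by
    intro j τ hτ
    obtain ⟨i, hi⟩ := ht ⟨τ, hτ⟩
    have := mk_add_eq_mk (w := w) c (fun i => (t i).1) hc j i
    rwa [hi] at this
  have hkey : ∀ γ γ' : (V ⊕ ℕ) →₀ ℕ, (∃ j r, γ = single (Sum.inr j) 1 + r) →
      (∃ j r, γ' = single (Sum.inr j) 1 + r) → linearCombination ℕ F γ = linearCombination ℕ F γ' →
      algLE p (linearCombination ℕ F γ) → algLE (linearCombination ℕ F γ) p →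
      (addConGen (vertexRel (extendRel w w'))).mk' γ =
        (addConGen (vertexRel (extendRel w w'))).mk' γ' := by
    rintro γ γ' ⟨j, r, hγ⟩ ⟨j', r', hγ'⟩ heq hpγ hγp
    obtain ⟨k, hk⟩ := hinv _ hpγ hγp
    have h1 := habsorb' j (single (Sum.inr k) 1 + γ') (by rw [map_add, hFinr, ← heq, hk, hpp])
    have h2 := habsorb' j' (single (Sum.inr k) 1 + γ) (by rw [map_add, hFinr, hk, hpp])
    generalize (addConGen (vertexRel (extendRel w w'))).mk' = ρ at *
    rw [map_add] at h1 h2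
    have h1' : ρ γ + (ρ (single (Sum.inr k) 1) + ρ γ') = ρ γ := by
      conv_rhs => rw [hγ, map_add, ← h1]
      conv_lhs => lhs; rw [hγ, map_add]
      abel
    have h2' : ρ γ' + (ρ (single (Sum.inr k) 1) + ρ γ) = ρ γ' := by
      conv_rhs => rw [hγ', map_add, ← h2]
      conv_lhs => lhs; rw [hγ', map_add]
      abel
    calc ρ γ = ρ γ + (ρ (single (Sum.inr k) 1) + ρ γ') := h1'.symm
      _ = ρ γ' + (ρ (single (Sum.inr k) 1) + ρ γ) := by abel
      _ = ρ γ' := h2'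
  refine ⟨fun k => (g k : M), w', ?_, ?_, ?_, ?_⟩
  · rintro (v | j)
    · exact fun h0 => h.ne_zero v
        (Finsupp.mapDomain_injective Sum.inl_injective (h0.trans Finsupp.mapDomain_zero.symm))
    · intro h0
      have := DFunLike.congr_fun h0 (Sum.inr j)
      simp [extendRel, w', regularRel] at this
  · ext y
    constructor
    · rintro ⟨η, rfl⟩
      obtain ⟨α, δ, rfl⟩ := exists_eq_mapDomain_add η
      change linearCombination ℕ F _ ∈ _
      rw [heval]
      by_cases hδ : δ = 0
      · rw [hδ, map_zero, add_zero]
        exact Or.inl (hmem α)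
      · exact Or.inr ⟨_, hmem α, _, ⟨(hgen δ hδ).2, hgenle δ⟩, rfl⟩
    · rintro (hy | ⟨n, hn, u, hu, rfl⟩)
      · rw [← h.range_eq] at hy
        obtain ⟨α, rfl⟩ := hy
        exact ⟨_, linearCombination_elim_inl f _ α⟩
      · rw [← h.range_eq] at hn
        obtain ⟨α, rfl⟩ := hn
        obtain ⟨k, hk⟩ := hg ⟨u, hu⟩
        refine ⟨_, (heval α (single k 1)).trans ?_⟩
        rw [Finsupp.linearCombination_single, one_smul, hk]
  · rintro (v | j)
    · exact (linearCombination_elim_inl _ _ _).trans (h.rel v)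
    · exact hrelp j
  · intro η η' heq
    obtain ⟨α, δ, rfl⟩ := exists_eq_mapDomain_add η
    obtain ⟨β, δ', rfl⟩ := exists_eq_mapDomain_add η'
    change linearCombination ℕ F _ = linearCombination ℕ F _ at heq
    rw [heval, heval] at heq
    have hnot : ∀ (α β : V →₀ ℕ) (δ : ℕ →₀ ℕ), δ ≠ 0 → linearCombination ℕ f α ≠
        linearCombination ℕ f β + linearCombination ℕ (fun k => (g k : M)) δ := by
      intro α β δ hδ h
      refine hpN (hN.2.2 _ _ ?_ (hmem α))
      rw [h]
      exact (hgen δ hδ).2.trans (algLE_add_left _ _)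
    rw [← AddCon.eq]
    change (addConGen (vertexRel (extendRel w w'))).mk' _ =
      (addConGen (vertexRel (extendRel w w'))).mk' _
    by_cases hδ : δ = 0
    · subst hδ
      rw [map_zero, add_zero] at heq
      by_cases hδ' : δ' = 0
      · subst hδ'
        rw [map_zero, add_zero] at heq
        rw [map_add, map_add, mk_mapDomain_inl w' (h.inj α β heq)]
      · exact absurd heq (hnot α β δ' hδ')
    by_cases hδ' : δ' = 0
    · subst hδ'
      rw [map_zero, add_zero] at heq
      exact absurd heq.symm (hnot β α δ hδ)
    obtain ⟨⟨j, r, hj⟩, hpδ⟩ := hgen δ hδ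
    obtain ⟨⟨j', r', hj'⟩, hpδ'⟩ := hgen δ' hδ'
    have hδp := hgenle δ
    have hδ'p := hgenle δ'
    obtain ⟨x, y, z, u, h1, h2, h3, h4⟩ := href _ _ _ _ heq
    have hmem' : ∀ {x}, (∃ z α, linearCombination ℕ f α = x + z) →
        ∃ ξ, linearCombination ℕ f ξ = x := by
      rintro x ⟨z, α, hz⟩
      have := hN.2.2 x _ ⟨z, hz⟩ (hmem α)
      rwa [← h.range_eq] at this
    obtain ⟨ξx, rfl⟩ := hmem' ⟨y, α, h1⟩
    obtain ⟨ξy, rfl⟩ := hmem' ⟨_, α, h1.trans (add_comm _ y)⟩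
    obtain ⟨ξz, rfl⟩ := hmem' ⟨_, β, h3.trans (add_comm _ z)⟩
    have hα := mk_mapDomain_inl w' (h.inj α (ξx + ξy) (by rw [h1, map_add]))
    have hβ := mk_mapDomain_inl w' (h.inj β (ξx + ξz) (by rw [h3, map_add]))
    have hyz := hkey (mapDomain Sum.inl ξy + mapDomain Sum.inr δ)
      (mapDomain Sum.inl ξz + mapDomain Sum.inr δ')
      ⟨j, mapDomain Sum.inl ξy + mapDomain Sum.inr r, by
        rw [hj, Finsupp.mapDomain_add, Finsupp.mapDomain_single, add_left_comm]⟩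
      ⟨j', mapDomain Sum.inl ξz + mapDomain Sum.inr r', by
        rw [hj', Finsupp.mapDomain_add, Finsupp.mapDomain_single, add_left_comm]⟩
      (by rw [heval, heval, h2, h4]; abel)
      (by rw [heval]; exact hpδ.trans (algLE_add_left _ _))
      (by
        rw [heval]
        exact hadd ((h4 ▸ algLE_add_right _ _ : algLE (linearCombination ℕ f ξy) _).trans hδ'p) hδp)
    rw [map_add, hα, map_add _ (mapDomain Sum.inl β), hβ, Finsupp.mapDomain_add,
      Finsupp.mapDomain_add, map_add, map_add, add_assoc, add_assoc, ← map_add, hyz, map_add]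

end RegularStep

section Induction

variable [AddMonoid.FG M] (hcon : IsConical M) (href : IsRefinement M)
include hcon href

theorem exists_larger_presentation
    (hcyc : ∀ p : M, IsPrimeElem p → IsFreeElem p → AbsorptionCyclic p) {N : Set M}
    (hN : IsOrderIdeal N) {V : Type} [Countable V] {f : V → M} {w : V → V →₀ ℕ}
    (h : IsPresentation N f w) {p : M} (hp : IsPrimeElem p) (hpN : p ∉ N)
    (hlt : ∀ q, IsPrimeElem q → classLT q p → q ∈ N) :
    ∃ N' : Set M, IsOrderIdeal N' ∧ N ⊆ N' ∧ p ∈ N' ∧ ∃ (V' : Type) (_ : Countable V')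
      (f' : V' → M) (w' : V' → V' →₀ ℕ), IsPresentation N' f' w' := by
  have := countable_of_fg M
  have hlt' : ∀ z, classLT z p → z ∈ N := fun z hz => mem_ideal_of_classLT hcon href hN hlt hz
  by_cases hfree : IsFreeElem p
  · have habs : ∀ u, algLE (p + u) p → u ∈ N := fun u hu => hlt' u (hfree.classLT_of_absorbed hu)
    obtain ⟨w', hw'⟩ := h.adjoin_free hN href hp hpN habs (hcyc p hp hfree)
    exact ⟨_, isOrderIdeal_add_nsmul hN href hp habs, fun n hn => ⟨n, hn, 0, by simp⟩,
      ⟨0, hN.1, 1, by simp⟩, _, inferInstance, _, _, hw'⟩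
  · obtain ⟨e, he, -, hpe, hep⟩ := exists_idempotent (hp.regular_of_not_free href hfree)
    have heN : e ∉ N := fun he => hpN (hN.2.2 _ _ hpe he)
    have hlte : ∀ z, classLT z e → z ∈ N := fun z hz => hlt' z (hz.trans_le hep)
    obtain ⟨g, w', hw'⟩ := h.adjoin_regular hN href he heN
    exact ⟨_, isOrderIdeal_union_add hN href he hlte, fun n hn => Or.inl hn,
      Or.inr ⟨0, hN.1, p, ⟨hep, hpe⟩, (zero_add p).symm⟩, _, inferInstance, _, _, hw'⟩

theorem isGraphMonoid_of_absorptionCyclic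
    (hcyc : ∀ p : M, IsPrimeElem p → IsFreeElem p → AbsorptionCyclic p) : IsGraphMonoid M := by
  classical
  obtain ⟨S, hS⟩ := AddMonoid.FG.fg_top (M := M)
  suffices key : ∀ (n : ℕ) (N : Set M), IsOrderIdeal N →
      (S.filter fun g => IsPrimeElem g ∧ g ∉ N).card = n → ∀ (V : Type) (_ : Countable V)
      (f : V → M) (w : V → V →₀ ℕ), IsPresentation N f w → IsGraphMonoid M by
    refine key _ {0} ⟨rfl, ?_, ?_⟩ rfl Empty inferInstance Empty.elim Empty.elim
      ⟨fun v => v.elim, ?_, fun v => v.elim, fun α β _ => ?_⟩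
    · rintro x y rfl rfl
      exact add_zero 0
    · rintro x y ⟨z, hz⟩ rfl
      exact (hcon x z hz.symm).1
    · ext x
      constructor
      · rintro ⟨α, rfl⟩
        rw [Subsingleton.elim α 0, map_zero]
        rfl
      · rintro rfl
        exact ⟨0, map_zero _⟩
    · rw [Subsingleton.elim α β]
      exact AddConGen.Rel.refl _
  intro n
  induction n using Nat.strong_induction_on with
  | _ n ih =>
    intro N hN hn V _ f w h
    by_cases hex : ∃ p, p ∈ {g | g ∈ S ∧ IsPrimeElem g ∧ g ∉ N}
    · obtain ⟨p, ⟨hpS, hp, hpN⟩, hmin⟩ := (wellFounded_classLT (M := M)).has_min _ hex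
      have hlt : ∀ q, IsPrimeElem q → classLT q p → q ∈ N := fun q hq hqp => by
        obtain ⟨g, hgS, hqg, hgq⟩ := exists_generator_equiv hS hq
        by_contra hqN
        exact hmin g ⟨hgS, hq.congr hqg hgq, fun hg => hqN (hN.2.2 _ _ hqg hg)⟩ (hqp.le_trans hgq)
      obtain ⟨N', hN', hsub, hpN', V', hV', f', w', h'⟩ :=
        exists_larger_presentation hcon href hcyc hN h hp hpN hlt
      refine ih _ ?_ N' hN' rfl V' hV' f' w' h'
      rw [← hn]
      refine Finset.card_lt_card (Finset.ssubset_iff_of_subset ?_ |>.2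
        ⟨p, Finset.mem_filter.2 ⟨hpS, hp, hpN⟩, fun hp' => (Finset.mem_filter.1 hp').2.2 hpN'⟩)
      exact Finset.monotone_filter_right _ fun g _ hg => ⟨hg.1, fun hgN => hg.2 (hsub hgN)⟩
    · have huniv : N = Set.univ := Set.eq_univ_of_forall fun x => by
        have hx := mem_closure_prime hcon href x
        induction hx using AddSubmonoid.closure_induction with
        | mem q hq =>
          obtain ⟨g, hgS, hqg, hgq⟩ := exists_generator_equiv hS hq
          by_contra hqN
          exact hex ⟨g, hgS, hq.congr hqg hgq, fun hg => hqN (hN.2.2 _ _ hqg hg)⟩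
        | zero => exact hN.1
        | add x y _ _ hx hy => exact hN.2.1 _ _ hx hy
      subst huniv
      exact h.isGraphMonoid

end Induction

end Construction
/-- **Main Theorem.** A finitely generated conical refinement monoid
`M` is a graph monoid if and only if for every free prime `p` of `M` which is not
minimal in the poset of primes, and every set `Q` of representatives of the lower
cover of `p̄`, the unique group homomorphism `G(φ_p) : G(M_{J_p}) → G'_p` induced
by `φ_p` on a Grothendieck group of `M_{J_p}` is an almost isomorphism: it is
surjective and its kernel is the cyclic subgroup generated by `ι x` for some
`x ∈ M_{J_p}`. -/
theorem isGraphMonoid_iff_almostIso (M : Type) [AddCommMonoid M] [AddMonoid.FG M]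
    (hcon : IsConical M) (href : IsRefinement M) :
    IsGraphMonoid M ↔
      ∀ p : M, IsPrimeElem p → IsFreeElem p →
        (∃ q : M, IsPrimeElem q ∧ classLT q p) →
        ∀ Q : Finset M, IsLowerCoverReps p Q → AlmostIsoCondition M p Q := by
  refine ⟨fun h p hp hfree _ Q hQ =>
    (h.absorptionCyclic hp hfree).almostIsoCondition hcon href hp hfree hQ, fun h => ?_⟩
  refine isGraphMonoid_of_absorptionCyclic hcon href fun p hp hfree => ?_
  by_cases hmin : ∃ q : M, IsPrimeElem q ∧ classLT q p
  · obtain ⟨Q, hQ⟩ := exists_isLowerCoverReps p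
    exact absorptionCyclic_of_almostIsoCondition hcon href hp hfree hQ (h p hp hfree hmin Q hQ)
  · have hzero : ∀ z : M, algLE (p + z) p → z = 0 := fun z hz =>
      mem_ideal_of_classLT (I := {0}) hcon href
        ⟨rfl, fun x y hx hy => by rw [hx, hy]; exact add_zero 0,
          fun x y ⟨u, hu⟩ hy => (hcon x u (hu.symm.trans hy)).1⟩
        (fun q hq hqp => absurd ⟨q, hq, hqp⟩ hmin) (hfree.classLT_of_absorbed hz)
    refine ⟨0, add_zero p, fun z hz => ⟨0, ?_⟩, fun u v hu huv => ⟨0, 0, ?_⟩⟩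
    · rw [hzero z hz]
      exact ⟨0, by simp⟩
    · rw [hzero u hu, hzero v (huv ▸ hu)]

end ArPardo
end
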